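/- arXiv:0805.4092 — 3 statements merged into one kernel-verified Lean document; each statement's English description precedes it below -/
import Mathlib

section
/- For every finite input alphabet X = {1,…,k}, every output dimension d, every probability vector p on X, and every real number R > 0, there exists a sequence of codes Φ_n = (M_n, φ_n, Y^n) depending only on p, R, k, and d (and not on the channel), such that lim_{n→∞} (1/n) log M_n = R, and for every classical-quantum channel W from X to d×d density matrices, liminf_{n→∞} (−1/n) log ε[Φ_n, W] ≥ sup_{0≤t<1} (φ_{W,p}(t) − tR)/(1+t). -/
open Matrix Filter
open scoped ComplexOrder

open Classical in
/-- The power `A^s` of a positive semidefinite (more generally Hermitian) matrix,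
obtained by applying `x ↦ x ^ s` to the eigenvalues in a spectral decomposition. -/
noncomputable def matRpow {ι : Type*} [Fintype ι] [DecidableEq ι]
    (A : Matrix ι ι ℂ) (s : ℝ) : Matrix ι ι ℂ :=
  if hA : A.IsHermitian then
    (hA.eigenvectorUnitary : Matrix ι ι ℂ) *
      Matrix.diagonal (fun i => ((hA.eigenvalues i ^ s : ℝ) : ℂ)) *
      star (hA.eigenvectorUnitary : Matrix ι ι ℂ)
  else 0

/-- The output state `W(x₁) ⊗ ⋯ ⊗ W(xₙ)` of `n` uses of the classical-quantum channel `W`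
on the input word `x`, as a matrix indexed by `Fin n → Fin d` (the `n`-fold Kronecker
product written with function indices). -/
def cqOut {k d n : ℕ} (W : Fin k → Matrix (Fin d) (Fin d) ℂ)
    (x : Fin n → Fin k) : Matrix (Fin n → Fin d) (Fin n → Fin d) ℂ :=
  fun v w => ∏ j, W (x j) (v j) (w j)

/-- A code for block length `n`: `M` messages, an encoder, and a decoder POVM
(positive semidefinite matrices summing to at most the identity). -/
structure CQCode (k d n : ℕ) where
  M : ℕ
  enc : Fin M → Fin n → Fin k
  dec : Fin M → Matrix (Fin n → Fin d) (Fin n → Fin d) ℂ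
  dec_psd : ∀ i, (dec i).PosSemidef
  dec_sum_le_one : (1 - ∑ i, dec i).PosSemidef

/-- Average error probability `ε[Φ, W] = (1/M) ∑ᵢ Tr[W_n(φ(i)) (I - Yᵢ)]`. -/
noncomputable def avgErr {k d n : ℕ} (W : Fin k → Matrix (Fin d) (Fin d) ℂ)
    (Φ : CQCode k d n) : ℝ :=
  (1 / Φ.M) * ∑ i, ((cqOut W (Φ.enc i) * (1 - Φ.dec i)).trace).re

/-- `φ_{W,p}(t) = -(1-t) log Tr[(∑ᵢ pᵢ W(i)^{1-t})^{1/(1-t)}]`. -/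
noncomputable def phiW {k d : ℕ} (W : Fin k → Matrix (Fin d) (Fin d) ℂ)
    (p : Fin k → ℝ) (t : ℝ) : ℝ :=
  -(1 - t) * Real.log
    ((matRpow (∑ i, (p i : ℂ) • matRpow (W i) (1 - t)) (1 / (1 - t))).trace.re)

section Helpers

open scoped MatrixOrder

section FunctionalCalculus

variable {ι κ : Type*} [Fintype ι] [DecidableEq ι] [Fintype κ] [DecidableEq κ]

open Classical in
/-- The Hermitian matrix `f(A)` obtained by applying `f` to the eigenvalues of `A`. -/
noncomputable def hermFun (f : ℝ → ℝ) (A : Matrix ι ι ℂ) : Matrix ι ι ℂ :=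
  if hA : A.IsHermitian then
    (hA.eigenvectorUnitary : Matrix ι ι ℂ) *
      Matrix.diagonal (fun i => ((f (hA.eigenvalues i) : ℝ) : ℂ)) *
      star (hA.eigenvectorUnitary : Matrix ι ι ℂ)
  else 0

theorem matRpow_eq_hermFun (A : Matrix ι ι ℂ) (s : ℝ) :
    matRpow A s = hermFun (fun x => x ^ s) A := rfl

theorem hermFun_of_isHermitian (f : ℝ → ℝ) {A : Matrix ι ι ℂ} (hA : A.IsHermitian) :
    hermFun f A = (hA.eigenvectorUnitary : Matrix ι ι ℂ) *
      diagonal (fun i => ((f (hA.eigenvalues i) : ℝ) : ℂ)) *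
      star (hA.eigenvectorUnitary : Matrix ι ι ℂ) := by
  rw [hermFun, dif_pos hA]

theorem Matrix.IsHermitian.eq_conj_diagonal {A : Matrix ι ι ℂ} (hA : A.IsHermitian) :
    A = (hA.eigenvectorUnitary : Matrix ι ι ℂ) *
      diagonal (fun i => ((hA.eigenvalues i : ℝ) : ℂ)) *
      star (hA.eigenvectorUnitary : Matrix ι ι ℂ) := by
  conv_lhs => rw [hA.spectral_theorem]
  rfl

theorem hermFun_mul_of_mul_diagonal (f : ℝ → ℝ) {A : Matrix ι ι ℂ} (hA : A.IsHermitian)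
    {V : Matrix ι κ ℂ} {b : κ → ℝ} (h : A * V = V * diagonal (fun i => (b i : ℂ))) :
    hermFun f A * V = V * diagonal (fun i => (f (b i) : ℂ)) := by
  set U : Matrix ι ι ℂ := (hA.eigenvectorUnitary : Matrix ι ι ℂ) with hU
  have hUU : star U * U = 1 := Unitary.coe_star_mul_self _
  have hUU' : U * star U = 1 := Unitary.coe_mul_star_self _
  have h1 : diagonal (fun i => ((hA.eigenvalues i : ℝ) : ℂ)) * (star U * V)
      = (star U * V) * diagonal (fun i => (b i : ℂ)) := by
    rw [Matrix.mul_assoc, ← h]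
    conv_rhs => rw [hA.eq_conj_diagonal]
    rw [← hU]
    simp only [← Matrix.mul_assoc, hUU, Matrix.one_mul]
  have h2 : diagonal (fun i => ((f (hA.eigenvalues i) : ℝ) : ℂ)) * (star U * V)
      = (star U * V) * diagonal (fun i => (f (b i) : ℂ)) := by
    ext i j
    have h3 := congrFun (congrFun h1 i) j
    rw [diagonal_mul, mul_diagonal] at h3 ⊢
    by_cases hY : (star U * V) i j = 0
    · simp [hY]
    · rw [mul_comm] at h3
      have h4 := mul_left_cancel₀ hY h3
      rw [Complex.ofReal_inj.mp h4, mul_comm]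
  rw [hermFun_of_isHermitian f hA, ← hU, Matrix.mul_assoc, Matrix.mul_assoc, h2, Matrix.mul_assoc,
    ← Matrix.mul_assoc U, hUU', Matrix.one_mul]

theorem hermFun_eq_of_mul_diagonal (f : ℝ → ℝ) {A : Matrix ι ι ℂ} (hA : A.IsHermitian)
    {V : Matrix ι κ ℂ} {b : κ → ℝ} (h : A * V = V * diagonal (fun i => (b i : ℂ)))
    (hV : V * Vᴴ = 1) :
    hermFun f A = V * diagonal (fun i => (f (b i) : ℂ)) * Vᴴ := by
  rw [← hermFun_mul_of_mul_diagonal f hA h, Matrix.mul_assoc, hV, Matrix.mul_one]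

/-- An intertwiner of `A` and `B` intertwines `f(A)` and `f(B)`. -/
theorem hermFun_intertwine (f : ℝ → ℝ) {A : Matrix ι ι ℂ} {B : Matrix κ κ ℂ}
    (hA : A.IsHermitian) (hB : B.IsHermitian) {X : Matrix ι κ ℂ} (h : A * X = X * B) :
    hermFun f A * X = X * hermFun f B := by
  set U : Matrix κ κ ℂ := (hB.eigenvectorUnitary : Matrix κ κ ℂ) with hU
  have hUU : star U * U = 1 := Unitary.coe_star_mul_self _
  have hUU' : U * star U = 1 := Unitary.coe_mul_star_self _
  have h1 : A * (X * U) = (X * U) * diagonal (fun i => ((hB.eigenvalues i : ℝ) : ℂ)) := by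
    rw [← Matrix.mul_assoc, h]
    conv_lhs => rw [hB.eq_conj_diagonal]
    rw [← hU]
    simp only [Matrix.mul_assoc, hUU, Matrix.mul_one]
  have h2 := hermFun_mul_of_mul_diagonal f hA h1
  rw [hermFun_of_isHermitian f hB, ← hU, ← Matrix.mul_assoc, ← Matrix.mul_assoc, ← h2]
  simp only [Matrix.mul_assoc, hUU', Matrix.mul_one]

theorem hermFun_isHermitian (f : ℝ → ℝ) (A : Matrix ι ι ℂ) : (hermFun f A).IsHermitian := by
  by_cases hA : A.IsHermitian
  · rw [hermFun_of_isHermitian f hA]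
    refine isHermitian_mul_mul_conjTranspose _ (isHermitian_diagonal_of_self_adjoint _ ?_)
    ext i
    simp
  · rw [hermFun, dif_neg hA]
    exact isHermitian_zero

theorem hermFun_posSemidef {f : ℝ → ℝ} {A : Matrix ι ι ℂ} (hA : A.IsHermitian)
    (hf : ∀ i, 0 ≤ f (hA.eigenvalues i)) : (hermFun f A).PosSemidef := by
  rw [hermFun_of_isHermitian f hA]
  refine PosSemidef.mul_mul_conjTranspose_same (PosSemidef.diagonal fun i => ?_) _
  simpa using hf i

theorem hermFun_mul (f g : ℝ → ℝ) {A : Matrix ι ι ℂ} (hA : A.IsHermitian) :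
    hermFun f A * hermFun g A = hermFun (fun x => f x * g x) A := by
  rw [hermFun_of_isHermitian f hA, hermFun_of_isHermitian g hA, hermFun_of_isHermitian _ hA]
  set U : Matrix ι ι ℂ := (hA.eigenvectorUnitary : Matrix ι ι ℂ) with hU
  have hUU : star U * U = 1 := Unitary.coe_star_mul_self _
  simp only [Matrix.mul_assoc]
  rw [← Matrix.mul_assoc (star U) U, hUU, Matrix.one_mul, ← Matrix.mul_assoc (diagonal _),
    diagonal_mul_diagonal]
  simp

theorem hermFun_congr {f g : ℝ → ℝ} {A : Matrix ι ι ℂ} (hA : A.IsHermitian)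
    (h : ∀ i, f (hA.eigenvalues i) = g (hA.eigenvalues i)) : hermFun f A = hermFun g A := by
  rw [hermFun_of_isHermitian f hA, hermFun_of_isHermitian g hA]
  simp [h]

theorem hermFun_id {A : Matrix ι ι ℂ} (hA : A.IsHermitian) : hermFun (fun x => x) A = A := by
  rw [hermFun_of_isHermitian _ hA, ← hA.eq_conj_diagonal]

theorem hermFun_one {A : Matrix ι ι ℂ} (hA : A.IsHermitian) : hermFun (fun _ => 1) A = 1 := by
  rw [hermFun_of_isHermitian _ hA]
  simp

theorem hermFun_sum {α : Type*} (s : Finset α) (f : α → ℝ → ℝ) {A : Matrix ι ι ℂ}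
    (hA : A.IsHermitian) :
    hermFun (fun x => ∑ a ∈ s, f a x) A = ∑ a ∈ s, hermFun (f a) A := by
  simp only [hermFun_of_isHermitian _ hA, ← Matrix.sum_mul, ← Matrix.mul_sum]
  congr 2
  ext i j
  by_cases h : i = j
  · subst h; simp [Matrix.sum_apply]
  · simp [Matrix.sum_apply, diagonal_apply_ne _ h]

theorem hermFun_submatrix (f : ℝ → ℝ) {A : Matrix ι ι ℂ} (hA : A.IsHermitian) (e : κ ≃ ι) :
    hermFun f (A.submatrix e e) = (hermFun f A).submatrix e e := by
  set U : Matrix ι ι ℂ := (hA.eigenvectorUnitary : Matrix ι ι ℂ) with hU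
  have hUU : star U * U = 1 := Unitary.coe_star_mul_self _
  have hUU' : U * Uᴴ = 1 := Unitary.coe_mul_star_self _
  have key : ∀ g : ℝ → ℝ, (hermFun g A).submatrix e e = U.submatrix e id *
      diagonal (fun i => ((g (hA.eigenvalues i) : ℝ) : ℂ)) * (U.submatrix e id)ᴴ := by
    intro g
    rw [hermFun_of_isHermitian g hA, ← hU]
    ext i j
    simp [Matrix.mul_apply, Matrix.star_apply]
  have h0 := key (fun x => x)
  rw [hermFun_id hA] at h0
  have hVV : (U.submatrix e id)ᴴ * U.submatrix e id = 1 := by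
    rw [conjTranspose_submatrix, ← submatrix_mul _ _ _ _ _ e.bijective]
    rw [← Matrix.star_eq_conjTranspose, hUU]
    simp
  have hVV' : U.submatrix e id * (U.submatrix e id)ᴴ = 1 := by
    rw [conjTranspose_submatrix, ← submatrix_mul _ _ _ _ _ Function.bijective_id, hUU']
    simp
  rw [key f]
  refine hermFun_eq_of_mul_diagonal f (hA.submatrix e) ?_ hVV'
  rw [h0, Matrix.mul_assoc, hVV, Matrix.mul_one]

end FunctionalCalculus

theorem le_iff_posSemidef_sub {ι : Type*} {A B : Matrix ι ι ℂ} : A ≤ B ↔ (B - A).PosSemidef :=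
  Matrix.le_iff

section Powers

variable {ι κ : Type*} [Fintype ι] [DecidableEq ι] [Fintype κ] [DecidableEq κ]

theorem matRpow_posSemidef {A : Matrix ι ι ℂ} (hA : A.PosSemidef) (s : ℝ) :
    (matRpow A s).PosSemidef := by
  rw [matRpow_eq_hermFun]
  exact hermFun_posSemidef hA.1 fun i => Real.rpow_nonneg (hA.eigenvalues_nonneg i) s

theorem matRpow_mul_matRpow {A : Matrix ι ι ℂ} (hA : A.PosSemidef) {s t : ℝ}
    (hs : 0 ≤ s) (ht : 0 ≤ t) : matRpow A s * matRpow A t = matRpow A (s + t) := by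
  simp only [matRpow_eq_hermFun]
  rw [hermFun_mul _ _ hA.1]
  exact hermFun_congr hA.1 fun i =>
    (Real.rpow_add_of_nonneg (hA.eigenvalues_nonneg i) hs ht).symm

theorem matRpow_one {A : Matrix ι ι ℂ} (hA : A.IsHermitian) : matRpow A 1 = A := by
  rw [matRpow_eq_hermFun]
  simpa using hermFun_id hA

theorem matRpow_half_mul_self {A : Matrix ι ι ℂ} (hA : A.PosSemidef) :
    matRpow A (1 / 2) * matRpow A (1 / 2) = A := by
  rw [matRpow_mul_matRpow hA (by norm_num) (by norm_num), add_halves, matRpow_one hA.1]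

theorem Matrix.PosSemidef.matRpow_mul_eigenvectorUnitary {A : Matrix ι ι ℂ} (hA : A.PosSemidef) (s : ℝ) :
    matRpow A s * (hA.1.eigenvectorUnitary : Matrix ι ι ℂ) =
      (hA.1.eigenvectorUnitary : Matrix ι ι ℂ) *
        diagonal (fun i => ((hA.1.eigenvalues i ^ s : ℝ) : ℂ)) := by
  rw [matRpow_eq_hermFun, hermFun_of_isHermitian _ hA.1, Matrix.mul_assoc,
    Unitary.coe_star_mul_self, Matrix.mul_one]

theorem matRpow_matRpow {A : Matrix ι ι ℂ} (hA : A.PosSemidef) (s r : ℝ) :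
    matRpow (matRpow A s) r = matRpow A (s * r) := by
  rw [matRpow_eq_hermFun (matRpow A s),
    hermFun_eq_of_mul_diagonal _ (matRpow_posSemidef hA s).1 (hA.matRpow_mul_eigenvectorUnitary s)
      (Unitary.coe_mul_star_self _), matRpow_eq_hermFun, hermFun_of_isHermitian _ hA.1]
  simp only [Real.rpow_mul (hA.eigenvalues_nonneg _)]
  rfl

theorem matRpow_smul {A : Matrix ι ι ℂ} (hA : A.PosSemidef) {c : ℝ} (hc : 0 ≤ c) (s : ℝ) :
    matRpow ((c : ℂ) • A) s = ((c ^ s : ℝ) : ℂ) • matRpow A s := by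
  have hcA : ((c : ℂ) • A).PosSemidef := hA.smul (by exact_mod_cast hc)
  have h1 : ((c : ℂ) • A) * (hA.1.eigenvectorUnitary : Matrix ι ι ℂ) =
      (hA.1.eigenvectorUnitary : Matrix ι ι ℂ) *
        diagonal (fun i => ((c * hA.1.eigenvalues i : ℝ) : ℂ)) := by
    have := hA.matRpow_mul_eigenvectorUnitary 1
    rw [matRpow_one hA.1] at this
    rw [smul_mul, this, ← Matrix.mul_smul, ← diagonal_smul]
    congr 2
    ext i
    simp
  rw [matRpow_eq_hermFun, hermFun_eq_of_mul_diagonal _ hcA.1 h1 (Unitary.coe_mul_star_self _),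
    matRpow_eq_hermFun, hermFun_of_isHermitian _ hA.1, ← smul_mul, ← Matrix.mul_smul,
    ← diagonal_smul]
  congr 3
  ext i
  simp [Real.mul_rpow hc (hA.eigenvalues_nonneg i)]

theorem matRpow_submatrix {A : Matrix ι ι ℂ} (hA : A.IsHermitian) (e : κ ≃ ι) (s : ℝ) :
    matRpow (A.submatrix e e) s = (matRpow A s).submatrix e e := by
  simp only [matRpow_eq_hermFun]
  exact hermFun_submatrix _ hA e

theorem Commute.matRpow_right {A X : Matrix ι ι ℂ} (h : Commute X A) (hA : A.IsHermitian) (s : ℝ) :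
    Commute X (matRpow A s) := by
  rw [matRpow_eq_hermFun]
  exact (hermFun_intertwine _ hA hA h.symm.eq).symm

theorem Commute.matRpow_left {A X : Matrix ι ι ℂ} (h : Commute A X) (hA : A.IsHermitian) (s : ℝ) :
    Commute (matRpow A s) X :=
  (h.symm.matRpow_right hA s).symm

open scoped Matrix.Norms.L2Operator in
theorem matRpow_eq_rpow {A : Matrix ι ι ℂ} (hA : A.PosSemidef) (s : ℝ) :
    matRpow A s = A ^ s := by
  rw [CFC.rpow_eq_cfc_real (ha := hA.nonneg), hA.1.cfc_eq, matRpow_eq_hermFun,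
    hermFun_of_isHermitian _ hA.1]
  rfl

open scoped Matrix.Norms.L2Operator in
/-- The Löwner–Heinz inequality. -/
theorem matRpow_le_matRpow {A B : Matrix ι ι ℂ} (hA : A.PosSemidef) (hAB : A ≤ B) {s : ℝ}
    (hs : 0 ≤ s) (hs1 : s ≤ 1) : matRpow A s ≤ matRpow B s := by
  have hB : B.PosSemidef := (hA.nonneg.trans hAB).posSemidef
  rw [matRpow_eq_rpow hA, matRpow_eq_rpow hB]
  exact CFC.rpow_le_rpow ⟨hs, hs1⟩ hAB

theorem conj_le_conj {A B : Matrix ι ι ℂ} (h : A ≤ B) {C : Matrix ι ι ℂ} (hC : C.IsHermitian) :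
    C * A * C ≤ C * B * C := by
  have := (le_iff_posSemidef_sub.mp h).mul_mul_conjTranspose_same C
  rw [hC.eq] at this
  rw [le_iff_posSemidef_sub]
  convert this using 1
  noncomm_ring

theorem Matrix.PosSemidef.mul_of_commute {A B : Matrix ι ι ℂ} (hA : A.PosSemidef)
    (hB : B.PosSemidef) (h : Commute A B) : (A * B).PosSemidef := by
  have h1 := hA.mul_mul_conjTranspose_same (matRpow B (1 / 2))
  rwa [(matRpow_posSemidef hB _).1.eq, ← (h.matRpow_right hB.1 (1 / 2)).eq, Matrix.mul_assoc,
    matRpow_half_mul_self hB] at h1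

theorem mul_le_mul_of_commute {A B X : Matrix ι ι ℂ} (h : A ≤ B) (hX : X.PosSemidef)
    (hAX : Commute A X) (hBX : Commute B X) : A * X ≤ B * X := by
  rw [le_iff_posSemidef_sub, ← Matrix.sub_mul]
  exact (le_iff_posSemidef_sub.mp h).mul_of_commute hX (hBX.sub_left hAX)

theorem trace_mul_re_nonneg {A B : Matrix ι ι ℂ} (hA : A.PosSemidef) (hB : B.PosSemidef) :
    0 ≤ (A * B).trace.re := by
  have h1 := (hA.mul_mul_conjTranspose_same (matRpow B (1 / 2))).trace_nonneg
  rw [(matRpow_posSemidef hB _).1.eq, trace_mul_comm, ← Matrix.mul_assoc,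
    matRpow_half_mul_self hB, trace_mul_comm] at h1
  exact (Complex.le_def.mp h1).1

theorem trace_mul_re_mono {A B C : Matrix ι ι ℂ} (h : A ≤ B) (hC : C.PosSemidef) :
    (A * C).trace.re ≤ (B * C).trace.re := by
  have := trace_mul_re_nonneg (le_iff_posSemidef_sub.mp h) hC
  rw [Matrix.sub_mul, trace_sub, Complex.sub_re] at this
  linarith

end Powers

section CauchySchwarz

variable {ι C : Type*} [Fintype ι]

/-- An operator-valued Cauchy–Schwarz inequality. -/
theorem sum_smul_mul_conjTranspose_le (s : Finset C) (β : C → ℂ) (B : C → Matrix ι ι ℂ) :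
    (∑ c ∈ s, β c • B c) * (∑ c ∈ s, β c • B c)ᴴ ≤
      (∑ c ∈ s, β c * star (β c)) • ∑ c ∈ s, B c * (B c)ᴴ := by
  have h : (∑ c ∈ s, ∑ e ∈ s, (star (β e) • B c - star (β c) • B e) *
      (star (β e) • B c - star (β c) • B e)ᴴ).PosSemidef :=
    posSemidef_sum _ fun c _ => posSemidef_sum _ fun e _ => posSemidef_self_mul_conjTranspose _
  have h2 := h.smul (a := (1 / 2 : ℂ)) (by rw [Complex.le_def]; norm_num)
  rw [le_iff_posSemidef_sub]
  convert h2 using 1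
  have expand : ∀ c e, (star (β e) • B c - star (β c) • B e) *
      (star (β e) • B c - star (β c) • B e)ᴴ =
      (β e * star (β e)) • (B c * (B c)ᴴ) + (β c * star (β c)) • (B e * (B e)ᴴ)
        - (β c * star (β e)) • (B c * (B e)ᴴ) - (β e * star (β c)) • (B e * (B c)ᴴ) := by
    intro c e
    simp only [conjTranspose_sub, conjTranspose_smul, star_star, Matrix.sub_mul, Matrix.mul_sub,
      Matrix.smul_mul, Matrix.mul_smul]
    module
  have e1 : ∑ c ∈ s, ∑ e ∈ s, (β e * star (β e)) • (B c * (B c)ᴴ) =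
      (∑ c ∈ s, β c * star (β c)) • ∑ c ∈ s, B c * (B c)ᴴ := by
    rw [Finset.smul_sum]
    exact Finset.sum_congr rfl fun c _ => by rw [Finset.sum_smul]
  have e2 : ∑ c ∈ s, ∑ e ∈ s, (β c * star (β c)) • (B e * (B e)ᴴ) =
      (∑ c ∈ s, β c * star (β c)) • ∑ c ∈ s, B c * (B c)ᴴ := by
    rw [Finset.sum_comm, e1]
  have e3 : ∑ c ∈ s, ∑ e ∈ s, (β c * star (β e)) • (B c * (B e)ᴴ) =
      (∑ c ∈ s, β c • B c) * (∑ c ∈ s, β c • B c)ᴴ := by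
    rw [conjTranspose_sum, Finset.sum_mul_sum]
    refine Finset.sum_congr rfl fun c _ => Finset.sum_congr rfl fun e _ => ?_
    rw [conjTranspose_smul, smul_mul, Matrix.mul_smul, smul_smul]
  have e4 : ∑ c ∈ s, ∑ e ∈ s, (β e * star (β c)) • (B e * (B c)ᴴ) =
      (∑ c ∈ s, β c • B c) * (∑ c ∈ s, β c • B c)ᴴ := by
    rw [Finset.sum_comm, e3]
  simp only [expand, Finset.sum_sub_distrib, Finset.sum_add_distrib, e1, e2, e3, e4]
  module

end CauchySchwarz

section Types

variable {T : Type*} [DecidableEq T] {n : ℕ}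

/-- The type (empirical count function) of a word. -/
def wordType (f : Fin n → T) (t : T) : Fin (n + 1) :=
  ⟨(Finset.univ.filter fun j => f j = t).card,
    Nat.lt_succ_of_le ((Finset.card_le_univ _).trans (Fintype.card_fin n).le)⟩

/-- Permuting the positions of a word. -/
def permWord {T : Type*} (π : Equiv.Perm (Fin n)) : (Fin n → T) ≃ (Fin n → T) where
  toFun f := f ∘ π
  invFun f := f ∘ π.symm
  left_inv f := by ext; simp
  right_inv f := by ext; simp

@[simp]
theorem permWord_apply {T : Type*} (π : Equiv.Perm (Fin n)) (f : Fin n → T) :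
    permWord π f = f ∘ π := rfl

@[simp]
theorem permWord_symm_apply {T : Type*} (π : Equiv.Perm (Fin n)) (f : Fin n → T) :
    (permWord π).symm f = f ∘ π.symm := rfl

theorem wordType_comp (f : Fin n → T) (π : Equiv.Perm (Fin n)) :
    wordType (f ∘ π) = wordType f := by
  ext t
  simp only [wordType, Function.comp_apply]
  exact Finset.card_bij' (fun j _ => π j) (fun j _ => π.symm j) (by simp) (by simp) (by simp)
    (by simp)

theorem exists_perm_of_wordType_eq {f g : Fin n → T} (h : wordType f = wordType g) :
    ∃ π : Equiv.Perm (Fin n), f ∘ π = g := by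
  have h1 : ∀ t, Nonempty ({j // g j = t} ≃ {j // f j = t}) := by
    intro t
    refine ⟨Fintype.equivOfCardEq ?_⟩
    have := congrArg Fin.val (congrFun h t)
    simp only [wordType] at this
    rw [Fintype.card_subtype, Fintype.card_subtype, this]
  let e : ∀ t, {j // g j = t} ≃ {j // f j = t} := fun t => (h1 t).some
  refine ⟨(Equiv.sigmaFiberEquiv g).symm.trans ((Equiv.sigmaCongrRight e).trans (Equiv.sigmaFiberEquiv f)), ?_⟩
  ext j
  exact (e (g j) ⟨j, rfl⟩).2

end Types

section Invariant

variable {k d n : ℕ}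

/-- Invariance under the permutations of the tensor factors that fix the word `x`. -/
def IsInv (x : Fin n → Fin k) (M : Matrix (Fin n → Fin d) (Fin n → Fin d) ℂ) : Prop :=
  ∀ π : Equiv.Perm (Fin n), x ∘ π = x → M.submatrix (permWord π) (permWord π) = M

namespace IsInv

variable {x : Fin n → Fin k} {M N : Matrix (Fin n → Fin d) (Fin n → Fin d) ℂ}

theorem mul (hM : IsInv x M) (hN : IsInv x N) : IsInv x (M * N) := fun π hπ => by
  rw [← submatrix_mul_equiv M N _ (permWord π) _, hM π hπ, hN π hπ]

theorem conjTranspose (hM : IsInv x M) : IsInv x Mᴴ := fun π hπ => by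
  rw [← conjTranspose_submatrix, hM π hπ]

theorem inv (hM : IsInv x M) : IsInv x M⁻¹ := fun π hπ => by
  rw [← inv_submatrix_equiv, hM π hπ]

theorem one : IsInv x (1 : Matrix (Fin n → Fin d) (Fin n → Fin d) ℂ) := fun π _ => by
  simp

theorem sum {C : Type*} (s : Finset C) {B : C → Matrix (Fin n → Fin d) (Fin n → Fin d) ℂ}
    (hB : ∀ c, IsInv x (B c)) : IsInv x (∑ c ∈ s, B c) := fun π hπ => by
  ext v w
  simp only [submatrix_apply, Matrix.sum_apply]
  exact Finset.sum_congr rfl fun c _ => congrFun (congrFun (hB c π hπ) v) w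

theorem hermFun (hM : IsInv x M) (hM' : M.IsHermitian) (f : ℝ → ℝ) : IsInv x (hermFun f M) :=
  fun π hπ => by rw [← hermFun_submatrix f hM', hM π hπ]

theorem matRpow (hM : IsInv x M) (hM' : M.IsHermitian) (s : ℝ) : IsInv x (matRpow M s) :=
  fun π hπ => by rw [← matRpow_submatrix hM', hM π hπ]

theorem of_const {i : Fin k} (hM : IsInv (fun _ => i) M) (x : Fin n → Fin k) : IsInv x M :=
  fun π _ => hM π rfl

end IsInv

/-- The joint type of the word `x` and a pair of indices. -/
def jointType (x : Fin n → Fin k) (v w : Fin n → Fin d) : Fin k × Fin d × Fin d → Fin (n + 1) :=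
  wordType fun j => (x j, v j, w j)

theorem jointType_comp (x : Fin n → Fin k) (v w : Fin n → Fin d) (π : Equiv.Perm (Fin n)) :
    jointType (x ∘ π) (v ∘ π) (w ∘ π) = jointType x v w :=
  wordType_comp (fun j => (x j, v j, w j)) π

theorem IsInv.apply_eq {x : Fin n → Fin k} {M : Matrix (Fin n → Fin d) (Fin n → Fin d) ℂ}
    (hM : IsInv x M) {v w v' w' : Fin n → Fin d} (h : jointType x v w = jointType x v' w') :
    M v w = M v' w' := by
  obtain ⟨π, hπ⟩ := exists_perm_of_wordType_eq h
  have h1 : ∀ j, x (π j) = x j ∧ v (π j) = v' j ∧ w (π j) = w' j := fun j => by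
    simpa using congrFun hπ j
  have hv : v ∘ π = v' := funext fun j => (h1 j).2.1
  have hw : w ∘ π = w' := funext fun j => (h1 j).2.2
  have h2 := congrFun (congrFun (hM π (funext fun j => (h1 j).1)) v) w
  rw [submatrix_apply, permWord_apply, permWord_apply, hv, hw] at h2
  exact h2.symm

/-- The number of index pairs of a given joint type with `x`. -/
def typeCount (d : ℕ) (x : Fin n → Fin k) (c : Fin k × Fin d × Fin d → Fin (n + 1)) : ℕ :=
  (Finset.univ.filter fun q : (Fin n → Fin d) × (Fin n → Fin d) =>
    jointType x q.1 q.2 = c).card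

/-- The normalized indicator matrices of the joint types: an orthonormal basis of the algebra of
matrices satisfying `IsInv x`. -/
noncomputable def typeBasis (x : Fin n → Fin k) (c : Fin k × Fin d × Fin d → Fin (n + 1)) :
    Matrix (Fin n → Fin d) (Fin n → Fin d) ℂ :=
  fun v w => if jointType x v w = c then (((Real.sqrt (typeCount d x c))⁻¹ : ℝ) : ℂ) else 0

theorem typeCount_comp (x : Fin n → Fin k) (c : Fin k × Fin d × Fin d → Fin (n + 1))
    (π : Equiv.Perm (Fin n)) : typeCount d (x ∘ π) c = typeCount d x c := by
  refine Finset.card_equiv ((permWord π).prodCongr (permWord π)).symm fun q => ?_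
  simp only [Finset.mem_filter, Finset.mem_univ, true_and]
  rw [← jointType_comp x _ _ π]
  simp [Function.comp_assoc]

theorem typeBasis_comp (x : Fin n → Fin k) (c : Fin k × Fin d × Fin d → Fin (n + 1))
    (π : Equiv.Perm (Fin n)) :
    (typeBasis (x ∘ π) c).submatrix (permWord π) (permWord π) = typeBasis x c := by
  ext v w
  simp only [submatrix_apply, permWord_apply, typeBasis, typeCount_comp, jointType_comp]

theorem typeBasis_isInv (x : Fin n → Fin k) (c : Fin k × Fin d × Fin d → Fin (n + 1)) :
    IsInv x (typeBasis x c) := fun π hπ => by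
  conv_lhs => rw [← hπ]
  exact typeBasis_comp x c π

theorem IsInv.eq_sum_typeBasis {x : Fin n → Fin k}
    {M : Matrix (Fin n → Fin d) (Fin n → Fin d) ℂ} (hM : IsInv x M) :
    M = ∑ c, ((typeBasis x c)ᴴ * M).trace • typeBasis x c := by
  ext v w
  simp only [Matrix.sum_apply, Matrix.smul_apply, smul_eq_mul]
  rw [Finset.sum_eq_single (jointType x v w)
    (fun c _ hc => by rw [typeBasis, if_neg (Ne.symm hc), mul_zero]) (by simp)]
  set N := typeCount d x (jointType x v w) with hN
  have hNpos : 0 < N := Finset.card_pos.mpr ⟨(v, w), by simp⟩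
  have h1 : ((typeBasis x (jointType x v w))ᴴ * M).trace =
      (N : ℂ) * ((((Real.sqrt N)⁻¹ : ℝ) : ℂ) * M v w) := by
    have h2 : ((typeBasis x (jointType x v w))ᴴ * M).trace = ∑ q : (Fin n → Fin d) × (Fin n → Fin d),
        if jointType x q.1 q.2 = jointType x v w then (((Real.sqrt N)⁻¹ : ℝ) : ℂ) * M v w else 0 := by
      rw [Fintype.sum_prod_type, Finset.sum_comm]
      simp only [Matrix.trace, Matrix.diag, Matrix.mul_apply, conjTranspose_apply, typeBasis]
      refine Finset.sum_congr rfl fun b _ => Finset.sum_congr rfl fun a _ => ?_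
      split_ifs with h
      · rw [hM.apply_eq h]
        simp [hN]
      · simp
    rw [h2, ← Finset.sum_filter, Finset.sum_const, nsmul_eq_mul]
    rfl
  have h3 : ((Real.sqrt N)⁻¹ : ℝ) * ((Real.sqrt N)⁻¹ : ℝ) = (N : ℝ)⁻¹ := by
    rw [← mul_inv, Real.mul_self_sqrt (by positivity)]
  have h4 : (((Real.sqrt N)⁻¹ : ℝ) : ℂ) * (((Real.sqrt N)⁻¹ : ℝ) : ℂ) = (N : ℂ)⁻¹ := by
    rw [← Complex.ofReal_mul, h3, Complex.ofReal_inv, Complex.ofReal_natCast]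
  have h5 : (N : ℂ) ≠ 0 := by exact_mod_cast hNpos.ne'
  rw [h1, typeBasis, if_pos rfl, ← hN]
  calc M v w = (N : ℂ) * (N : ℂ)⁻¹ * M v w := by rw [mul_inv_cancel₀ h5, one_mul]
    _ = _ := by rw [← h4]; ring

/-- The universal operator of the algebra of matrices satisfying `IsInv x`. -/
noncomputable def univOp (d : ℕ) (x : Fin n → Fin k) : Matrix (Fin n → Fin d) (Fin n → Fin d) ℂ :=
  ∑ c, typeBasis x c * (typeBasis x c)ᴴ

theorem univOp_posSemidef (x : Fin n → Fin k) : (univOp d x).PosSemidef :=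
  posSemidef_sum _ fun _ _ => posSemidef_self_mul_conjTranspose _

theorem univOp_isInv (x : Fin n → Fin k) : IsInv x (univOp d x) :=
  IsInv.sum _ fun c => (typeBasis_isInv x c).mul (typeBasis_isInv x c).conjTranspose

theorem univOp_comp (x : Fin n → Fin k) (π : Equiv.Perm (Fin n)) :
    (univOp d (x ∘ π)).submatrix (permWord π) (permWord π) = univOp d x := by
  have h : ∀ c : Fin k × Fin d × Fin d → Fin (n + 1),
      (typeBasis (x ∘ π) c * (typeBasis (x ∘ π) c)ᴴ).submatrix (permWord π) (permWord π) =
        typeBasis x c * (typeBasis x c)ᴴ := fun c => by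
    rw [← submatrix_mul_equiv _ _ _ (permWord π) _, ← conjTranspose_submatrix, typeBasis_comp]
  ext v w
  simp only [univOp, submatrix_apply, Matrix.sum_apply]
  exact Finset.sum_congr rfl fun c _ => congrFun (congrFun (h c) v) w

theorem IsInv.commute_univOp {x : Fin n → Fin k}
    {M : Matrix (Fin n → Fin d) (Fin n → Fin d) ℂ} (hM : IsInv x M) : Commute M (univOp d x) := by
  have h1 : M * univOp d x = ∑ c, ∑ e, ((typeBasis x e)ᴴ * (M * typeBasis x c)).trace •
      (typeBasis x e * (typeBasis x c)ᴴ) := by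
    rw [univOp, Finset.mul_sum]
    refine Finset.sum_congr rfl fun c _ => ?_
    rw [← Matrix.mul_assoc]
    conv_lhs => rw [(hM.mul (typeBasis_isInv x c)).eq_sum_typeBasis]
    rw [Finset.sum_mul]
    exact Finset.sum_congr rfl fun e _ => Matrix.smul_mul _ _ _
  have h2 : univOp d x * M = ∑ e, ∑ c, ((typeBasis x e)ᴴ * (M * typeBasis x c)).trace •
      (typeBasis x e * (typeBasis x c)ᴴ) := by
    rw [univOp, Finset.sum_mul]
    refine Finset.sum_congr rfl fun e _ => ?_
    have h3 : (typeBasis x e)ᴴ * M = (Mᴴ * typeBasis x e)ᴴ := by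
      rw [conjTranspose_mul, conjTranspose_conjTranspose]
    rw [Matrix.mul_assoc, h3]
    conv_lhs => rw [(hM.conjTranspose.mul (typeBasis_isInv x e)).eq_sum_typeBasis]
    rw [conjTranspose_sum, Finset.mul_sum]
    refine Finset.sum_congr rfl fun c _ => ?_
    rw [conjTranspose_smul, Matrix.mul_smul, ← trace_conjTranspose]
    simp only [conjTranspose_mul, conjTranspose_conjTranspose, Matrix.mul_assoc]
  rw [Commute, SemiconjBy, h1, h2, Finset.sum_comm]

theorem trace_univOp_le (x : Fin n → Fin k) :
    (univOp d x).trace.re ≤ ((n : ℝ) + 1) ^ (k * (d * d)) := by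
  have h : ∀ c : Fin k × Fin d × Fin d → Fin (n + 1),
      (typeBasis x c * (typeBasis x c)ᴴ).trace.re ≤ 1 := by
    intro c
    have h2 : (typeBasis x c * (typeBasis x c)ᴴ).trace =
        ∑ q : (Fin n → Fin d) × (Fin n → Fin d), if jointType x q.1 q.2 = c then
          (((Real.sqrt (typeCount d x c))⁻¹ : ℝ) : ℂ) *
            (((Real.sqrt (typeCount d x c))⁻¹ : ℝ) : ℂ) else 0 := by
      rw [Fintype.sum_prod_type]
      simp only [Matrix.trace, Matrix.diag, Matrix.mul_apply, conjTranspose_apply, typeBasis]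
      refine Finset.sum_congr rfl fun b _ => Finset.sum_congr rfl fun a _ => ?_
      split_ifs with h <;> simp
    rw [h2, ← Finset.sum_filter, Finset.sum_const, nsmul_eq_mul, ← Complex.ofReal_mul, ← mul_inv,
      Real.mul_self_sqrt (by positivity)]
    change (((typeCount d x c : ℕ) : ℂ) * _).re ≤ 1
    rw [← Complex.ofReal_natCast, ← Complex.ofReal_mul, Complex.ofReal_re]
    exact mul_inv_le_one
  rw [univOp, trace_sum, Complex.re_sum]
  refine (Finset.sum_le_sum fun c _ => h c).trans ?_
  simp

/-- `univOp` dominates every `b bᴴ` with `b` in the invariant algebra. -/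
theorem IsInv.mul_conjTranspose_le {x : Fin n → Fin k}
    {b : Matrix (Fin n → Fin d) (Fin n → Fin d) ℂ} (hb : IsInv x b) :
    b * bᴴ ≤ (bᴴ * b).trace • univOp d x := by
  have h := sum_smul_mul_conjTranspose_le Finset.univ
    (fun c => ((typeBasis x c)ᴴ * b).trace) (typeBasis x)
  rw [← hb.eq_sum_typeBasis] at h
  refine h.trans (le_of_eq ?_)
  rw [univOp]
  congr 1
  have h2 : bᴴ * b = ∑ c, ((typeBasis x c)ᴴ * b).trace • (bᴴ * typeBasis x c) := by
    conv_lhs =>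
      rhs
      rw [hb.eq_sum_typeBasis]
    rw [Finset.mul_sum]
    exact Finset.sum_congr rfl fun c _ => Matrix.mul_smul _ _ _
  rw [h2, trace_sum]
  refine Finset.sum_congr rfl fun c _ => ?_
  rw [trace_smul, smul_eq_mul, ← trace_conjTranspose, conjTranspose_mul,
    conjTranspose_conjTranspose]

end Invariant

section Outputs

variable {k d n : ℕ}

theorem IsInv.le_trace_smul_univOp {x : Fin n → Fin k}
    {T : Matrix (Fin n → Fin d) (Fin n → Fin d) ℂ} (hT : IsInv x T) (hT' : T.PosSemidef) :
    T ≤ T.trace • univOp d x := by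
  have h := (hT.matRpow hT'.1 (1 / 2)).mul_conjTranspose_le
  rwa [(matRpow_posSemidef hT' _).1.eq, matRpow_half_mul_self hT'] at h

theorem univOp_posDef (hd : 0 < d) (x : Fin n → Fin k) : (univOp d x).PosDef := by
  have h := (IsInv.one (x := x) (d := d)).le_trace_smul_univOp PosSemidef.one
  rw [trace_one, le_iff_posSemidef_sub] at h
  have h1 : ((Fintype.card (Fin n → Fin d) : ℂ) • univOp d x).PosDef := by
    have := PosDef.one.add_posSemidef h
    rwa [add_sub_cancel] at this
  have hc : (0 : ℝ) < Fintype.card (Fin n → Fin d) := by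
    have : 0 < Fintype.card (Fin n → Fin d) := by
      rw [Fintype.card_fun, Fintype.card_fin, Fintype.card_fin]; positivity
    exact_mod_cast this
  have h2 := h1.smul (Complex.zero_lt_real.mpr (inv_pos.mpr hc))
  rwa [smul_smul, ← Complex.ofReal_natCast, ← Complex.ofReal_mul, inv_mul_cancel₀ hc.ne',
    Complex.ofReal_one, one_smul] at h2

theorem cqOut_mul (W V : Fin k → Matrix (Fin d) (Fin d) ℂ) (x : Fin n → Fin k) :
    cqOut W x * cqOut V x = cqOut (fun i => W i * V i) x := by
  ext v w
  simp only [cqOut, Matrix.mul_apply, ← Finset.prod_mul_distrib]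
  rw [Finset.prod_univ_sum, Fintype.piFinset_univ]

theorem cqOut_conjTranspose (W : Fin k → Matrix (Fin d) (Fin d) ℂ) (x : Fin n → Fin k) :
    (cqOut W x)ᴴ = cqOut (fun i => (W i)ᴴ) x := by
  ext v w
  simp [cqOut, conjTranspose_apply]

theorem cqOut_diagonal (f : Fin k → Fin d → ℂ) (x : Fin n → Fin k) :
    cqOut (fun i => diagonal (f i)) x = diagonal (fun v => ∏ j, f (x j) (v j)) := by
  ext v w
  by_cases h : v = w
  · subst h
    simp [cqOut]
  · obtain ⟨j, hj⟩ := Function.ne_iff.mp h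
    rw [diagonal_apply_ne _ h]
    exact Finset.prod_eq_zero (Finset.mem_univ j) (diagonal_apply_ne _ hj)

theorem cqOut_one (x : Fin n → Fin k) :
    cqOut (fun _ => (1 : Matrix (Fin d) (Fin d) ℂ)) x = 1 := by
  have := cqOut_diagonal (fun _ _ => (1 : ℂ)) x (d := d)
  simpa using this

theorem trace_cqOut (W : Fin k → Matrix (Fin d) (Fin d) ℂ) (x : Fin n → Fin k) :
    (cqOut W x).trace = ∏ j, (W (x j)).trace := by
  simp only [Matrix.trace, Matrix.diag, cqOut]
  rw [Finset.prod_univ_sum, Fintype.piFinset_univ]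

theorem cqOut_submatrix (W : Fin k → Matrix (Fin d) (Fin d) ℂ) (x : Fin n → Fin k)
    (π : Equiv.Perm (Fin n)) :
    (cqOut W (x ∘ π)).submatrix (permWord π) (permWord π) = cqOut W x := by
  ext v w
  simp only [submatrix_apply, cqOut, permWord_apply, Function.comp_apply]
  exact Equiv.prod_comp π fun j => W (x j) (v j) (w j)

theorem cqOut_isInv (W : Fin k → Matrix (Fin d) (Fin d) ℂ) (x : Fin n → Fin k) :
    IsInv x (cqOut W x) := fun π hπ => by
  conv_lhs => rw [← hπ]
  exact cqOut_submatrix W x π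

theorem cqOut_posSemidef {W : Fin k → Matrix (Fin d) (Fin d) ℂ} (hW : ∀ i, (W i).PosSemidef)
    (x : Fin n → Fin k) : (cqOut W x).PosSemidef := by
  have h : cqOut W x = cqOut (fun i => matRpow (W i) (1 / 2)) x *
      (cqOut (fun i => matRpow (W i) (1 / 2)) x)ᴴ := by
    rw [cqOut_conjTranspose, cqOut_mul]
    congr 1
    ext1 i
    rw [(matRpow_posSemidef (hW i) _).1.eq, matRpow_half_mul_self (hW i)]
  rw [h]
  exact posSemidef_self_mul_conjTranspose _

theorem matRpow_cqOut {W : Fin k → Matrix (Fin d) (Fin d) ℂ} (hW : ∀ i, (W i).PosSemidef)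
    (x : Fin n → Fin k) (s : ℝ) : matRpow (cqOut W x) s = cqOut (fun i => matRpow (W i) s) x := by
  have key : ∀ r : ℝ, cqOut (fun i => matRpow (W i) r) x *
      cqOut (fun i => ((hW i).1.eigenvectorUnitary : Matrix (Fin d) (Fin d) ℂ)) x =
      cqOut (fun i => ((hW i).1.eigenvectorUnitary : Matrix (Fin d) (Fin d) ℂ)) x *
        diagonal (fun v => ((∏ j, (hW (x j)).1.eigenvalues (v j) ^ r : ℝ) : ℂ)) := fun r => by
    have h1 := cqOut_diagonal (fun i a => (((hW i).1.eigenvalues a ^ r : ℝ) : ℂ)) x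
    simp only [← Complex.ofReal_prod] at h1
    rw [← h1, cqOut_mul, cqOut_mul]
    congr 1
    ext1 i
    exact (hW i).matRpow_mul_eigenvectorUnitary r
  have hV : cqOut (fun i => ((hW i).1.eigenvectorUnitary : Matrix (Fin d) (Fin d) ℂ)) x *
      (cqOut (fun i => ((hW i).1.eigenvectorUnitary : Matrix (Fin d) (Fin d) ℂ)) x)ᴴ = 1 := by
    rw [cqOut_conjTranspose, cqOut_mul, ← cqOut_one x]
    congr 1
    ext1 i
    exact Unitary.coe_mul_star_self _
  have h1 := key 1
  simp only [matRpow_one (hW _).1, Real.rpow_one] at h1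
  rw [matRpow_eq_hermFun, hermFun_eq_of_mul_diagonal _ (cqOut_posSemidef hW x).1 h1 hV]
  simp only [← Real.finsetProd_rpow _ _ (fun j _ => (hW (x j)).eigenvalues_nonneg _)]
  rw [← key s, Matrix.mul_assoc, hV, Matrix.mul_one]

theorem cqOut_le_univOp {W : Fin k → Matrix (Fin d) (Fin d) ℂ}
    (hW : ∀ i, (W i).PosSemidef ∧ (W i).trace = 1) (x : Fin n → Fin k) :
    cqOut W x ≤ univOp d x := by
  have h := (cqOut_isInv W x).le_trace_smul_univOp (cqOut_posSemidef (fun i => (hW i).1) x)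
  rwa [trace_cqOut, Finset.prod_congr rfl (fun j _ => (hW (x j)).2), Finset.prod_const_one,
    one_smul] at h

theorem sum_prod_smul_cqOut (p : Fin k → ℝ) (V : Fin k → Matrix (Fin d) (Fin d) ℂ)
    (y : Fin n → Fin k) :
    ∑ x : Fin n → Fin k, ((∏ j, p (x j) : ℝ) : ℂ) • cqOut V x =
      cqOut (fun _ => ∑ i, (p i : ℂ) • V i) y := by
  ext v w
  simp only [Matrix.sum_apply, Matrix.smul_apply, cqOut, smul_eq_mul, Complex.ofReal_prod,
    ← Finset.prod_mul_distrib]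
  rw [Finset.prod_univ_sum, Fintype.piFinset_univ]

theorem cqOut_const_isInv (K : Matrix (Fin d) (Fin d) ℂ) (i : Fin k) :
    IsInv (fun _ : Fin n => i) (cqOut (fun _ : Fin k => K) (fun _ => i)) :=
  cqOut_isInv _ _

end Outputs

section SpectralProjection

variable {ι : Type*} [Fintype ι] [DecidableEq ι]

/-- The spectral projection of a Hermitian matrix onto the eigenspace of `l`. -/
noncomputable def specProj (Z : Matrix ι ι ℂ) (l : ℝ) : Matrix ι ι ℂ :=
  hermFun (fun x => if x = l then 1 else 0) Z

theorem specProj_isHermitian (Z : Matrix ι ι ℂ) (l : ℝ) : (specProj Z l).IsHermitian :=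
  hermFun_isHermitian _ _

theorem specProj_mul_self {Z : Matrix ι ι ℂ} (hZ : Z.IsHermitian) (l : ℝ) :
    specProj Z l * specProj Z l = specProj Z l := by
  rw [specProj, hermFun_mul _ _ hZ]
  congr 1
  ext x
  split_ifs <;> simp

theorem specProj_posSemidef {Z : Matrix ι ι ℂ} (hZ : Z.IsHermitian) (l : ℝ) :
    (specProj Z l).PosSemidef :=
  hermFun_posSemidef hZ fun i => by split_ifs <;> simp

theorem specProj_le_one {Z : Matrix ι ι ℂ} (hZ : Z.IsHermitian) (l : ℝ) : specProj Z l ≤ 1 := by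
  have h : ((1 - specProj Z l) * (1 - specProj Z l)ᴴ).PosSemidef :=
    posSemidef_self_mul_conjTranspose _
  have h1 : (1 - specProj Z l) * (1 - specProj Z l)ᴴ = 1 - specProj Z l := by
    rw [conjTranspose_sub, conjTranspose_one, (specProj_isHermitian Z l).eq, Matrix.sub_mul,
      Matrix.mul_sub, Matrix.mul_sub, specProj_mul_self hZ]
    simp
  rwa [h1, ← le_iff_posSemidef_sub] at h

theorem mul_specProj {Z : Matrix ι ι ℂ} (hZ : Z.IsHermitian) (l : ℝ) :
    Z * specProj Z l = (l : ℂ) • specProj Z l := by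
  conv_lhs => lhs; rw [← hermFun_id hZ]
  rw [specProj, hermFun_mul _ _ hZ]
  have h : ((l : ℂ) • (1 : Matrix ι ι ℂ)) = hermFun (fun _ => l) Z := by
    rw [hermFun_of_isHermitian _ hZ, ← smul_one_eq_diagonal]
    simp
  rw [← Matrix.one_mul (hermFun (fun x => if x = l then 1 else 0) Z), ← Matrix.smul_mul, h,
    hermFun_mul _ _ hZ]
  exact hermFun_congr hZ fun i => by split_ifs with h <;> simp [h]

theorem matRpow_mul_specProj {Z : Matrix ι ι ℂ} (hZ : Z.IsHermitian) (l s : ℝ) :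
    matRpow Z s * specProj Z l = ((l ^ s : ℝ) : ℂ) • specProj Z l := by
  have h := hermFun_mul_of_mul_diagonal (fun x => x ^ s) hZ (V := specProj Z l) (b := fun _ => l) (by
    rw [mul_specProj hZ, ← smul_one_eq_diagonal, Matrix.mul_smul, Matrix.mul_one])
  rw [matRpow_eq_hermFun, h, ← smul_one_eq_diagonal, Matrix.mul_smul, Matrix.mul_one]

theorem sum_specProj {Z : Matrix ι ι ℂ} (hZ : Z.IsHermitian) :
    ∑ l ∈ Finset.univ.image hZ.eigenvalues, specProj Z l = 1 := by
  rw [← hermFun_one hZ]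
  simp only [specProj]
  rw [← hermFun_sum _ (fun l x => if x = l then (1 : ℝ) else 0) hZ]
  exact hermFun_congr hZ fun i => by simp

theorem Commute.specProj_right {Z X : Matrix ι ι ℂ} (h : Commute X Z) (hZ : Z.IsHermitian) (l : ℝ) :
    Commute X (specProj Z l) :=
  (hermFun_intertwine _ hZ hZ h.symm.eq).symm

theorem specProj_ne_zero {Z : Matrix ι ι ℂ} (hZ : Z.IsHermitian) {l : ℝ}
    (hl : l ∈ Finset.univ.image hZ.eigenvalues) : specProj Z l ≠ 0 := by
  obtain ⟨i, -, rfl⟩ := Finset.mem_image.mp hl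
  intro h
  have h1 := hermFun_mul_of_mul_diagonal (fun x => if x = hZ.eigenvalues i then 1 else 0) hZ
    (V := (hZ.eigenvectorUnitary : Matrix ι ι ℂ)) (b := hZ.eigenvalues) (by
      conv_lhs => lhs; rw [hZ.eq_conj_diagonal]
      rw [Matrix.mul_assoc, Unitary.coe_star_mul_self, Matrix.mul_one])
  have h2 := congrArg (fun M => star (hZ.eigenvectorUnitary : Matrix ι ι ℂ) * M) h1
  rw [specProj] at h
  simp only [h, ← Matrix.mul_assoc, Unitary.coe_star_mul_self] at h2
  have h3 := congrFun (congrFun h2 i) i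
  simp at h3

/-- The pinching inequality, tested against a positive semidefinite matrix. -/
theorem trace_mul_re_le_pinching {Z W G : Matrix ι ι ℂ} (hZ : Z.IsHermitian) (hW : W.PosSemidef)
    (hG : G.PosSemidef) :
    (W * G).trace.re ≤ (Finset.univ.image hZ.eigenvalues).card *
      ∑ l ∈ Finset.univ.image hZ.eigenvalues,
        (W * (specProj Z l * G * specProj Z l)).trace.re := by
  have h := sum_smul_mul_conjTranspose_le (Finset.univ.image hZ.eigenvalues) (fun _ => (1 : ℂ))
    (fun l => specProj Z l * matRpow W (1 / 2))
  simp only [one_smul, star_one, mul_one, Finset.sum_const, nsmul_eq_mul] at h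
  rw [← Finset.sum_mul, sum_specProj hZ, Matrix.one_mul, (matRpow_posSemidef hW _).1.eq,
    matRpow_half_mul_self hW] at h
  refine (trace_mul_re_mono h hG).trans (le_of_eq ?_)
  rw [Matrix.smul_mul, trace_smul, smul_eq_mul, Finset.sum_mul, trace_sum, ← Complex.ofReal_natCast,
    Complex.re_ofReal_mul, Complex.re_sum]
  congr 1
  refine Finset.sum_congr rfl fun l _ => ?_
  rw [conjTranspose_mul, (matRpow_posSemidef hW _).1.eq, (specProj_isHermitian Z l).eq]
  rw [Matrix.mul_assoc, Matrix.mul_assoc, ← Matrix.mul_assoc (matRpow W _),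
    ← Matrix.mul_assoc (matRpow W _), matRpow_half_mul_self hW, trace_mul_comm]
  simp only [Matrix.mul_assoc]

/-- A Hayashi–Nagaoka type inequality compressed to an eigenspace of `Z`. -/
theorem specProj_mul_mul_specProj_le {Z B T T' : Matrix ι ι ℂ} (hZ : Z.PosSemidef)
    (hB : B.PosSemidef) (hT : T = matRpow (Z + B) (1 / 2)) (hTT' : T * T' = 1)
    {l : ℝ} (hl : 0 < l) :
    specProj Z l * (T' * B * T') * specProj Z l ≤
      ((4 / l : ℝ) : ℂ) • (specProj Z l * B * specProj Z l) := by
  have hS : (Z + B).PosSemidef := hZ.add hB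
  have hT'T : T' * T = 1 := mul_eq_one_comm.mp hTT'
  have hTT : T * T = Z + B := by rw [hT, matRpow_half_mul_self hS]
  have hTh : T.IsHermitian := hT ▸ (matRpow_posSemidef hS _).1
  have hT'h : T'.IsHermitian := by
    have : T'ᴴ * T = 1 := by
      rw [← hTh.eq, ← conjTranspose_mul, hTT', conjTranspose_one]
    exact left_inv_eq_right_inv this hTT'
  set P := specProj Z l with hP
  have hPh : P.IsHermitian := specProj_isHermitian Z l
  have hPP : P * P = P := specProj_mul_self hZ.1 l
  have hZP : Z * P = (l : ℂ) • P := mul_specProj hZ.1 l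
  set c : ℝ := (Real.sqrt l)⁻¹ with hc
  have hc0 : 0 < c := inv_pos.mpr (Real.sqrt_pos.mpr hl)
  have hcc : c * c * l = 1 := by
    rw [hc, ← mul_inv, Real.mul_self_sqrt hl.le, inv_mul_cancel₀ hl.ne']
  have hcl : c * l ^ (1 / 2 : ℝ) = 1 := by
    rw [← Real.sqrt_eq_rpow, hc, inv_mul_cancel₀ (Real.sqrt_pos.mpr hl).ne']
  have d1 : (P * ((2 * c : ℂ) • 1 - T') * B * (P * ((2 * c : ℂ) • 1 - T'))ᴴ).PosSemidef :=
    hB.mul_mul_conjTranspose_same _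
  have d2 : (P * (T' - (c : ℂ) • 1) * Z * (P * (T' - (c : ℂ) • 1))ᴴ).PosSemidef :=
    hZ.mul_mul_conjTranspose_same _
  have d3 : (P * (T - matRpow Z (1 / 2)) * Pᴴ).PosSemidef := by
    refine PosSemidef.mul_mul_conjTranspose_same ?_ _
    rw [← le_iff_posSemidef_sub, hT]
    refine matRpow_le_matRpow hZ ?_ (by norm_num) (by norm_num)
    rw [le_iff_posSemidef_sub, add_sub_cancel_left]
    exact hB
  have hB' : B = T * T - Z := by rw [hTT]; abel
  have c1 : star (2 * c : ℂ) = 2 * c := by simp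
  have c2 : star (c : ℂ) = c := by simp
  have h4 : (0 : ℂ) ≤ ((4 * c : ℝ) : ℂ) := by
    rw [Complex.zero_le_real]; positivity
  have h2 : (0 : ℂ) ≤ ((2 : ℝ) : ℂ) := by
    rw [Complex.zero_le_real]; positivity
  have hsum := (d1.add (d2.smul h2)).add (d3.smul h4)
  rw [le_iff_posSemidef_sub]
  convert hsum using 1
  have hZhP : P * matRpow Z (1 / 2) * P = ((l ^ (1 / 2 : ℝ) : ℝ) : ℂ) • P := by
    rw [Matrix.mul_assoc, matRpow_mul_specProj hZ.1, Matrix.mul_smul, ← hP, hPP]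
  have hPZP : P * (Z * P) = (l : ℂ) • P := by rw [hZP, Matrix.mul_smul, hPP]
  have r1 : ∀ X, T' * (T * X) = X := fun X => by rw [← Matrix.mul_assoc, hT'T, Matrix.one_mul]
  have r2 : ∀ X, T * (T' * X) = X := fun X => by rw [← Matrix.mul_assoc, hTT', Matrix.one_mul]
  have e3 : P * (T - matRpow Z (1 / 2)) * Pᴴ = P * (T * P) - ((l ^ (1 / 2 : ℝ) : ℝ) : ℂ) • P := by
    rw [hPh.eq, Matrix.mul_sub, Matrix.sub_mul, hZhP, Matrix.mul_assoc]
  rw [e3]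
  simp only [conjTranspose_mul, conjTranspose_sub, conjTranspose_smul, c1, c2,
    hPh.eq, hT'h.eq, hB', Matrix.mul_sub, Matrix.sub_mul, Matrix.mul_smul, Matrix.smul_mul,
    Matrix.mul_one, Matrix.mul_assoc, r1, r2, hPZP, hPP, smul_sub, smul_smul]
  have q1 : ((4 / l : ℝ) : ℂ) = 4 * c * c := by
    have : 4 / l = 4 * c * c := by
      field_simp
      linarith
    rw [this]; push_cast; ring
  have q2 : (c : ℂ) * c * l = 1 := by exact_mod_cast hcc
  have q3 : (c : ℂ) * ((l ^ (1 / 2 : ℝ) : ℝ) : ℂ) = 1 := by exact_mod_cast hcl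
  have q4 : ((4 * c : ℝ) : ℂ) * ((l ^ (1 / 2 : ℝ) : ℝ) : ℂ) = 4 := by
    push_cast at q3 ⊢
    rw [mul_assoc, q3, mul_one]
  rw [q1, q4]
  push_cast
  have q5 : (4 * c * c * l : ℂ) = 4 := by linear_combination 4 * q2
  have q6 : (2 * c * (2 * c * l) : ℂ) = 4 := by linear_combination 4 * q2
  have q7 : (2 * (c * (c * l)) : ℂ) = 2 := by linear_combination 2 * q2
  rw [q5, q6, q7]
  module

end SpectralProjection

section SquareRootMeasurement

variable {ι : Type*} [Fintype ι] [DecidableEq ι]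

theorem le_rpow_mul_rpow_of_le {x a b θ : ℝ} (hx : 0 ≤ x) (ha : x ≤ a) (hb : x ≤ b)
    (hθ : 0 ≤ θ) (hθ1 : θ ≤ 1) : x ≤ a ^ (1 - θ) * b ^ θ := by
  calc x = x ^ (1 - θ) * x ^ θ := by
        rw [← Real.rpow_add_of_nonneg hx (by linarith) hθ, sub_add_cancel, Real.rpow_one]
    _ ≤ _ := mul_le_mul (Real.rpow_le_rpow hx ha (by linarith)) (Real.rpow_le_rpow hx hb hθ)
        (Real.rpow_nonneg hx _) (Real.rpow_nonneg (hx.trans ha) _)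

theorem Commute.nonsing_inv_right {A B : Matrix ι ι ℂ} (h : Commute A B) (hB : IsUnit B) :
    Commute A B⁻¹ := by
  have h1 := (Matrix.isUnit_iff_isUnit_det B).mp hB
  have h2 : B⁻¹ * (A * B) * B⁻¹ = B⁻¹ * (B * A) * B⁻¹ := by rw [h.eq]
  rw [← Matrix.mul_assoc B⁻¹ B, nonsing_inv_mul _ h1, Matrix.one_mul, Matrix.mul_assoc,
    Matrix.mul_assoc, mul_nonsing_inv _ h1, Matrix.mul_one] at h2
  exact h2.symm

theorem posDef_mul_inv {O Q : Matrix ι ι ℂ} (hO : O.PosDef) (hQ : Q.PosDef) (h : Commute Q O) :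
    (Q * O⁻¹).PosDef := by
  have h1 := hQ.posSemidef.mul_of_commute hO.inv.posSemidef (h.nonsing_inv_right hO.isUnit)
  exact h1.posDef_iff_isUnit.mpr (hQ.isUnit.mul hO.inv.isUnit)

theorem trace_mul_specProj_le {O Q W : Matrix ι ι ℂ} (hO : O.PosDef) (hQ : Q.PosDef)
    (hQO : Commute Q O) (hW : W.PosSemidef) (hWQ : W ≤ Q) (hWQ' : Commute W Q) {t : ℝ}
    (ht : 0 ≤ t) (ht1 : t < 1) {l : ℝ} (hl : 0 ≤ l) :
    (W * specProj (Q * O⁻¹) l).trace.re ≤ l ^ t * (matRpow W (1 - t) * matRpow O t).trace.re := by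
  have hZ := posDef_mul_inv hO hQ hQO
  have hdet := (Matrix.isUnit_iff_isUnit_det O).mp hO.isUnit
  have hQZ : Commute Q (Q * O⁻¹) := (Commute.refl Q).mul_right (hQO.nonsing_inv_right hO.isUnit)
  have hOZ : Commute O (Q * O⁻¹) :=
    hQO.symm.mul_right ((Commute.refl O).nonsing_inv_right hO.isUnit)
  set P := specProj (Q * O⁻¹) l with hP
  have hOP : Commute O P := hOZ.specProj_right hZ.1 l
  have hPpsd : P.PosSemidef := specProj_posSemidef hZ.1 l
  have h1 : Q * P = P * ((l : ℂ) • O) := by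
    calc Q * P = Q * O⁻¹ * P * O := by
          rw [Matrix.mul_assoc (Q * O⁻¹), ← hOP.eq, Matrix.mul_assoc Q, ← Matrix.mul_assoc O⁻¹,
            nonsing_inv_mul _ hdet, Matrix.one_mul]
      _ = P * ((l : ℂ) • O) := by
          rw [hP, mul_specProj hZ.1, Matrix.smul_mul, Matrix.mul_smul]
  have hlO : ((l : ℂ) • O).IsHermitian := (hO.posSemidef.smul (Complex.zero_le_real.mpr hl)).1
  have h2 : matRpow Q t * P = ((l ^ t : ℝ) : ℂ) • (P * matRpow O t) := by
    rw [← Matrix.mul_smul, ← matRpow_smul hO.posSemidef hl, matRpow_eq_hermFun, matRpow_eq_hermFun]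
    exact hermFun_intertwine _ hQ.1 hlO h1
  have h3 : P * matRpow O t ≤ matRpow O t := by
    have := mul_le_mul_of_commute (specProj_le_one hZ.1 l) (matRpow_posSemidef hO.posSemidef t)
      (hOP.symm.matRpow_right hO.1 t) (Commute.one_left _)
    rwa [Matrix.one_mul] at this
  set V := matRpow W ((1 - t) / 2) with hV
  have hVh : V.IsHermitian := (matRpow_posSemidef hW _).1
  have hVV : V * V = matRpow W (1 - t) := by
    rw [hV, matRpow_mul_matRpow hW (by linarith) (by linarith), add_halves]
  have h4 : V * matRpow W t * V = W := by
    rw [hV, matRpow_mul_matRpow hW (by linarith) ht,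
      matRpow_mul_matRpow hW (by linarith) (by linarith)]
    rw [show (1 - t) / 2 + t + (1 - t) / 2 = 1 by ring, matRpow_one hW.1]
  have h5 : W ≤ V * matRpow Q t * V := by
    conv_lhs => rw [← h4]
    exact conj_le_conj (matRpow_le_matRpow hW hWQ ht ht1.le) hVh
  have h6 : V * matRpow Q t * V = matRpow W (1 - t) * matRpow Q t := by
    rw [Matrix.mul_assoc, ← ((hWQ'.matRpow_right hQ.1 t).matRpow_left hW.1 ((1 - t) / 2)).eq,
      ← Matrix.mul_assoc, hVV]
  have h7 := trace_mul_re_mono h5 hPpsd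
  rw [h6, Matrix.mul_assoc, h2, Matrix.mul_smul, trace_smul, smul_eq_mul,
    Complex.re_ofReal_mul] at h7
  refine h7.trans (mul_le_mul_of_nonneg_left ?_ (Real.rpow_nonneg hl t))
  rw [trace_mul_comm, trace_mul_comm (matRpow W (1 - t))]
  exact trace_mul_re_mono h3 (matRpow_posSemidef hW _)

/-- Error bound for one codeword of the square root measurement built from `Q * O⁻¹`. -/
theorem trace_mul_sqrt_measurement_le {O Q W B T T' : Matrix ι ι ℂ} (hO : O.PosDef)
    (hQ : Q.PosDef) (hQO : Commute Q O) (hW : W.PosSemidef) (hWQ : W ≤ Q) (hWQ' : Commute W Q)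
    (hB : B.PosSemidef) (hT : T = matRpow (Q * O⁻¹ + B) (1 / 2)) (hTT' : T * T' = 1)
    {t : ℝ} (ht : 0 ≤ t) (ht1 : t < 1) {D : ℝ}
    (hD : ∀ hZ : (Q * O⁻¹).IsHermitian, ((Finset.univ.image hZ.eigenvalues).card : ℝ) ≤ D) :
    (W * (T' * B * T')).trace.re ≤
      D ^ 2 * ((matRpow W (1 - t) * matRpow O t).trace.re ^ (1 / (1 + t)) *
        (4 * (Q * B).trace.re) ^ (t / (1 + t))) := by
  have hZ := posDef_mul_inv hO hQ hQO
  have hQZ : Commute Q (Q * O⁻¹) := (Commute.refl Q).mul_right (hQO.nonsing_inv_right hO.isUnit)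
  set Z := Q * O⁻¹ with hZdef
  set a := (matRpow W (1 - t) * matRpow O t).trace.re with ha
  set b := (Q * B).trace.re with hb
  have ha0 : 0 ≤ a :=
    trace_mul_re_nonneg (matRpow_posSemidef hW _) (matRpow_posSemidef hO.posSemidef _)
  have hb0 : 0 ≤ b := trace_mul_re_nonneg hQ.posSemidef hB
  have hS : (Z + B).PosSemidef := hZ.posSemidef.add hB
  have hT'T : T' * T = 1 := mul_eq_one_comm.mp hTT'
  have hTT : T * T = Z + B := by rw [hT, matRpow_half_mul_self hS]
  have hTh : T.IsHermitian := hT ▸ (matRpow_posSemidef hS _).1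
  have hT'h : T'.IsHermitian := by
    have : T'ᴴ * T = 1 := by
      rw [← hTh.eq, ← conjTranspose_mul, hTT', conjTranspose_one]
    exact left_inv_eq_right_inv this hTT'
  have hG : (T' * B * T').PosSemidef := by
    have := hB.mul_mul_conjTranspose_same T'
    rwa [hT'h.eq] at this
  have hG1 : T' * B * T' ≤ 1 := by
    have := hZ.posSemidef.mul_mul_conjTranspose_same T'
    rw [le_iff_posSemidef_sub]
    convert this using 1
    have hB' : B = T * T - Z := by rw [hTT]; abel
    rw [hT'h.eq, hB', Matrix.mul_sub, Matrix.sub_mul, ← Matrix.mul_assoc, hT'T, Matrix.one_mul, hTT']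
    abel
  have hterm : ∀ l ∈ Finset.univ.image hZ.1.eigenvalues,
      (W * (specProj Z l * (T' * B * T') * specProj Z l)).trace.re ≤
        a ^ (1 / (1 + t)) * (4 * b) ^ (t / (1 + t)) := by
    intro l hl
    obtain ⟨i, -, rfl⟩ := Finset.mem_image.mp hl
    have hl0 := hZ.eigenvalues_pos i
    set l := hZ.1.eigenvalues i with hldef
    set P := specProj Z l with hP
    have hPh : P.IsHermitian := specProj_isHermitian Z l
    have hPP : P * P = P := specProj_mul_self hZ.1 l
    have hPG : (P * (T' * B * T') * P).PosSemidef := by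
      have := hG.mul_mul_conjTranspose_same P
      rwa [hPh.eq] at this
    have h1 : (W * (P * (T' * B * T') * P)).trace.re ≤ l ^ t * a := by
      refine le_trans ?_ (trace_mul_specProj_le hO hQ hQO hW hWQ hWQ' ht ht1 hl0.le)
      rw [trace_mul_comm, trace_mul_comm W]
      refine trace_mul_re_mono ?_ hW
      have := conj_le_conj hG1 hPh
      rwa [Matrix.mul_one, hPP] at this
    have h2 : (W * (P * (T' * B * T') * P)).trace.re ≤ 4 / l * b := by
      have h3 : (W * (P * (T' * B * T') * P)).trace.re ≤ 4 / l * (W * (P * B * P)).trace.re := by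
        have h4 := trace_mul_re_mono
          (specProj_mul_mul_specProj_le hZ.posSemidef hB hT hTT' hl0) hW
        rw [Matrix.smul_mul, trace_smul, smul_eq_mul, Complex.re_ofReal_mul] at h4
        rwa [trace_mul_comm, trace_mul_comm W]
      refine h3.trans (mul_le_mul_of_nonneg_left ?_ (by positivity))
      have h4 : P * W * P ≤ Q := by
        refine (conj_le_conj hWQ hPh).trans ?_
        have hQP : Commute Q P := hQZ.specProj_right hZ.1 l
        rw [← hQP.eq, Matrix.mul_assoc, hPP, hQP.eq]
        have := mul_le_mul_of_commute (specProj_le_one hZ.1 l) hQ.posSemidef hQP.symm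
          (Commute.one_left _)
        rwa [Matrix.one_mul] at this
      have h5 : (W * (P * B * P)).trace = (P * W * P * B).trace := by
        rw [← Matrix.mul_assoc, trace_mul_comm]
        simp only [Matrix.mul_assoc]
      rw [h5]
      exact trace_mul_re_mono h4 hB
    have h3 := le_rpow_mul_rpow_of_le (trace_mul_re_nonneg hW hPG) h1 h2
      (θ := t / (1 + t)) (by positivity) (by rw [div_le_one (by linarith)]; linarith)
    refine h3.trans (le_of_eq ?_)
    have e1 : 1 - t / (1 + t) = 1 / (1 + t) := by field_simp; ring
    rw [e1, show 4 / l * b = l⁻¹ * (4 * b) by ring,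
      Real.mul_rpow (by positivity) ha0, Real.mul_rpow (by positivity) (by positivity),
      ← Real.rpow_mul hl0.le, Real.inv_rpow hl0.le, mul_one_div]
    field_simp
  have hD1 := hD hZ.1
  have hD0 : (0 : ℝ) ≤ (Finset.univ.image hZ.1.eigenvalues).card := Nat.cast_nonneg _
  have hX : 0 ≤ a ^ (1 / (1 + t)) * (4 * b) ^ (t / (1 + t)) := by positivity
  refine (trace_mul_re_le_pinching hZ.1 hW hG).trans ?_
  calc _ ≤ ((Finset.univ.image hZ.1.eigenvalues).card : ℝ) *
        ((Finset.univ.image hZ.1.eigenvalues).card • (a ^ (1 / (1 + t)) *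
          (4 * b) ^ (t / (1 + t)))) :=
        mul_le_mul_of_nonneg_left (Finset.sum_le_card_nsmul _ _ _ hterm) hD0
    _ = ((Finset.univ.image hZ.1.eigenvalues).card : ℝ) ^ 2 * (a ^ (1 / (1 + t)) *
          (4 * b) ^ (t / (1 + t))) := by rw [nsmul_eq_mul]; ring
    _ ≤ _ := mul_le_mul_of_nonneg_right (by gcongr) hX

end SquareRootMeasurement

theorem Complex.exists_ofReal_eq_of_nonneg {z : ℂ} (hz : 0 ≤ z) : ∃ r : ℝ, 0 ≤ r ∧ (r : ℂ) = z :=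
  ⟨z.re, (Complex.nonneg_iff.mp hz).1, Complex.ext rfl (Complex.nonneg_iff.mp hz).2⟩

section Decoder

variable {k d n : ℕ}

/-- The universal operator of a word relative to the fully symmetric universal operator. -/
noncomputable def testOp (d : ℕ) (i₀ : Fin k) (x : Fin n → Fin k) :
    Matrix (Fin n → Fin d) (Fin n → Fin d) ℂ :=
  univOp d x * (univOp d (fun _ : Fin n => i₀))⁻¹

theorem commute_univOp_const (i₀ : Fin k) (x : Fin n → Fin k) :
    Commute (univOp d x) (univOp d (fun _ : Fin n => i₀)) :=
  (((univOp_isInv (fun _ : Fin n => i₀)).of_const x).commute_univOp).symm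

theorem testOp_posDef (hd : 0 < d) (i₀ : Fin k) (x : Fin n → Fin k) : (testOp d i₀ x).PosDef :=
  posDef_mul_inv (univOp_posDef hd _) (univOp_posDef hd _) (commute_univOp_const i₀ x)

theorem testOp_isInv (i₀ : Fin k) (x : Fin n → Fin k) : IsInv x (testOp d i₀ x) :=
  (univOp_isInv x).mul (((univOp_isInv (fun _ : Fin n => i₀)).of_const x).inv)

theorem IsInv.card_eigenvalues_le {x : Fin n → Fin k}
    {Z : Matrix (Fin n → Fin d) (Fin n → Fin d) ℂ} (hZ : IsInv x Z) (hZ' : Z.IsHermitian) :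
    ((Finset.univ.image hZ'.eigenvalues).card : ℝ) ≤ ((n : ℝ) + 1) ^ (k * (d * d)) := by
  refine le_trans ?_ (trace_univOp_le x)
  have h1 : ∀ l ∈ Finset.univ.image hZ'.eigenvalues,
      1 ≤ (univOp d x * specProj Z l).trace.re := fun l hl => by
    have hP : IsInv x (specProj Z l) := hZ.hermFun hZ' _
    have hPpsd := specProj_posSemidef hZ' l
    have h2 := trace_mul_re_mono (hP.le_trace_smul_univOp hPpsd) hPpsd
    have h3 : 0 < (specProj Z l).trace :=
      lt_of_le_of_ne hPpsd.trace_nonneg fun h =>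
        specProj_ne_zero hZ' hl (hPpsd.trace_eq_zero_iff.mp h.symm)
    obtain ⟨r, -, hr'⟩ := Complex.exists_ofReal_eq_of_nonneg hPpsd.trace_nonneg
    rw [← hr', Complex.zero_lt_real] at h3
    rw [specProj_mul_self hZ', Matrix.smul_mul, trace_smul, smul_eq_mul, ← hr',
      Complex.re_ofReal_mul, Complex.ofReal_re] at h2
    nlinarith
  calc ((Finset.univ.image hZ'.eigenvalues).card : ℝ)
      = ∑ l ∈ Finset.univ.image hZ'.eigenvalues, 1 := by simp
    _ ≤ ∑ l ∈ Finset.univ.image hZ'.eigenvalues, (univOp d x * specProj Z l).trace.re :=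
        Finset.sum_le_sum h1
    _ = (univOp d x).trace.re := by
        rw [← Complex.re_sum, ← trace_sum, ← Finset.mul_sum, sum_specProj hZ', Matrix.mul_one]

/-- For every list of codewords there is a decoder, independent of the channel, whose error
probabilities are controlled for all channels simultaneously. -/
theorem exists_universal_decoder (hd : 0 < d) (i₀ : Fin k) {M : ℕ} (hM : 0 < M)
    (x : Fin M → Fin n → Fin k) :
    ∃ Y : Fin M → Matrix (Fin n → Fin d) (Fin n → Fin d) ℂ,
      (∀ i, (Y i).PosSemidef) ∧ ∑ i, Y i = 1 ∧
      ∀ W : Fin k → Matrix (Fin d) (Fin d) ℂ, (∀ i, (W i).PosSemidef ∧ (W i).trace = 1) →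
        ∀ t : ℝ, 0 ≤ t → t < 1 → ∀ i,
          (cqOut W (x i) * (1 - Y i)).trace.re ≤ (((n : ℝ) + 1) ^ (k * (d * d))) ^ 2 *
            ((cqOut (fun a => matRpow (W a) (1 - t)) (x i) *
              matRpow (univOp d (fun _ : Fin n => i₀)) t).trace.re ^ (1 / (1 + t)) *
            (4 * ∑ j ∈ Finset.univ.erase i,
              (univOp d (x i) * testOp d i₀ (x j)).trace.re) ^ (t / (1 + t))) := by
  have hZ : ∀ i, (testOp d i₀ (x i)).PosDef := fun i => testOp_posDef hd i₀ (x i)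
  set S := ∑ j, testOp d i₀ (x j) with hS
  have hSsplit : ∀ i, S = testOp d i₀ (x i) + ∑ j ∈ Finset.univ.erase i, testOp d i₀ (x j) :=
    fun i => (Finset.add_sum_erase _ _ (Finset.mem_univ i)).symm
  have hBpsd : ∀ i, (∑ j ∈ Finset.univ.erase i, testOp d i₀ (x j)).PosSemidef :=
    fun i => posSemidef_sum _ fun j _ => (hZ j).posSemidef
  have hSpd : S.PosDef := by
    rw [hSsplit ⟨0, hM⟩]
    exact (hZ _).add_posSemidef (hBpsd _)
  set T := matRpow S (1 / 2) with hT
  have hTT : T * T = S := matRpow_half_mul_self hSpd.posSemidef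
  have hTh : T.IsHermitian := (matRpow_posSemidef hSpd.posSemidef _).1
  have hTdet : IsUnit T.det := by
    have h := (Matrix.isUnit_iff_isUnit_det S).mp hSpd.isUnit
    rw [← hTT, det_mul] at h
    exact isUnit_of_mul_isUnit_left h
  have hTT' : T * T⁻¹ = 1 := mul_nonsing_inv _ hTdet
  have hT'T : T⁻¹ * T = 1 := nonsing_inv_mul _ hTdet
  have hSum : T⁻¹ * S * T⁻¹ = 1 := by
    rw [← hTT, ← Matrix.mul_assoc, hT'T, Matrix.one_mul, hTT']
  refine ⟨fun i => T⁻¹ * testOp d i₀ (x i) * T⁻¹, fun i => ?_, ?_, fun W hW t ht ht1 i => ?_⟩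
  · have := (hZ i).posSemidef.mul_mul_conjTranspose_same T⁻¹
    rwa [hTh.inv.eq] at this
  · rw [← Finset.sum_mul, ← Finset.mul_sum, ← hS, hSum]
  · have h1 : 1 - T⁻¹ * testOp d i₀ (x i) * T⁻¹ =
        T⁻¹ * (∑ j ∈ Finset.univ.erase i, testOp d i₀ (x j)) * T⁻¹ := by
      rw [← hSum, ← Matrix.sub_mul, ← Matrix.mul_sub, hSsplit i, add_sub_cancel_left]
    rw [h1, ← matRpow_cqOut fun i => (hW i).1, ← Complex.re_sum, ← trace_sum, ← Finset.mul_sum]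
    refine trace_mul_sqrt_measurement_le (univOp_posDef hd _) (univOp_posDef hd _)
      (commute_univOp_const i₀ (x i)) (cqOut_posSemidef (fun i => (hW i).1) _)
      (cqOut_le_univOp hW _) (cqOut_isInv W (x i)).commute_univOp (hBpsd i) ?_ hTT' ht ht1
      fun hZ' => (testOp_isInv i₀ (x i)).card_eigenvalues_le hZ'
    rw [hT, hSsplit i]
    rfl

end Decoder

section TypeClass

variable {k d n : ℕ}

theorem trace_submatrix_perm {ι : Type*} [Fintype ι] (A : Matrix ι ι ℂ) (e : ι ≃ ι) :
    (A.submatrix e e).trace = A.trace :=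
  Equiv.sum_comp e fun i => A i i

/-- A type class that carries a polynomially large share of an i.i.d. distribution. -/
theorem exists_dominating_word (p : Fin k → ℝ) (hp : ∀ i, 0 ≤ p i) (hp1 : ∑ i, p i = 1) (n : ℕ) :
    ∃ x₀ : Fin n → Fin k, ∀ h : (Fin n → Fin k) → ℝ, (∀ x, 0 ≤ h x) →
      (∀ x (π : Equiv.Perm (Fin n)), h (x ∘ π) = h x) →
      h x₀ ≤ ((n : ℝ) + 1) ^ k * ∑ x, (∏ j, p (x j)) * h x := by
  have hq : ∀ x : Fin n → Fin k, 0 ≤ ∏ j, p (x j) := fun x => Finset.prod_nonneg fun j _ => hp _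
  have hq1 : ∑ x : Fin n → Fin k, ∏ j, p (x j) = 1 := by
    have := Finset.prod_univ_sum (fun _ : Fin n => (Finset.univ : Finset (Fin k))) fun _ i => p i
    rw [Fintype.piFinset_univ] at this
    rw [← this]
    simp [hp1]
  set m : (Fin k → Fin (n + 1)) → ℝ :=
    fun τ => ∑ x : Fin n → Fin k with wordType x = τ, ∏ j, p (x j) with hm
  have hsum : ∑ τ, m τ = 1 := by
    rw [← hq1]
    exact Finset.sum_fiberwise _ _ _
  have hN : (0 : ℝ) < ((n : ℝ) + 1) ^ k := by positivity
  obtain ⟨τ, -, hτ⟩ : ∃ τ ∈ Finset.univ, (((n : ℝ) + 1) ^ k)⁻¹ ≤ m τ := by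
    refine Finset.exists_le_of_sum_le Finset.univ_nonempty ?_
    rw [hsum, Finset.sum_const, Finset.card_univ, Fintype.card_fun, Fintype.card_fin,
      Fintype.card_fin, nsmul_eq_mul]
    push_cast
    exact (mul_inv_cancel₀ hN.ne').le
  have hne : (Finset.univ.filter fun x : Fin n → Fin k => wordType x = τ).Nonempty := by
    by_contra h
    rw [Finset.not_nonempty_iff_eq_empty] at h
    have h0 : m τ = 0 := by rw [hm]; simp only [h, Finset.sum_empty]
    rw [h0] at hτ
    exact absurd hτ (not_le.mpr (by positivity))
  obtain ⟨x₀, hx₀⟩ := hne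
  refine ⟨x₀, fun h hh hinv => ?_⟩
  have h1 : m τ * h x₀ ≤ ∑ x, (∏ j, p (x j)) * h x := by
    rw [hm, Finset.sum_mul]
    refine le_trans (le_of_eq ?_) (Finset.sum_le_sum_of_subset_of_nonneg (Finset.filter_subset
      (fun x : Fin n → Fin k => wordType x = τ) _) fun x _ _ => mul_nonneg (hq x) (hh x))
    refine Finset.sum_congr rfl fun x hx => ?_
    obtain ⟨π, hπ⟩ := exists_perm_of_wordType_eq
      ((Finset.mem_filter.mp hx₀).2.trans (Finset.mem_filter.mp hx).2.symm)
    rw [← hπ, hinv]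
  calc h x₀ = ((n : ℝ) + 1) ^ k * ((((n : ℝ) + 1) ^ k)⁻¹ * h x₀) := by
        rw [← mul_assoc, mul_inv_cancel₀ hN.ne', one_mul]
    _ ≤ ((n : ℝ) + 1) ^ k * ∑ x, (∏ j, p (x j)) * h x :=
        mul_le_mul_of_nonneg_left ((mul_le_mul_of_nonneg_right hτ (hh _)).trans h1) hN.le

theorem trace_cqOut_mul_comp (V : Fin k → Matrix (Fin d) (Fin d) ℂ) {i₀ : Fin k}
    {N : Matrix (Fin n → Fin d) (Fin n → Fin d) ℂ} (hN : IsInv (fun _ => i₀) N)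
    (x : Fin n → Fin k) (π : Equiv.Perm (Fin n)) :
    (cqOut V (x ∘ π) * N).trace = (cqOut V x * N).trace := by
  rw [← trace_submatrix_perm (cqOut V (x ∘ π) * N) (permWord π),
    ← submatrix_mul_equiv _ _ _ (permWord π) _, cqOut_submatrix, hN π rfl]

theorem trace_matRpow_sum_pos {W : Fin k → Matrix (Fin d) (Fin d) ℂ}
    (hW : ∀ i, (W i).PosSemidef ∧ (W i).trace = 1) (p : Fin k → ℝ) (hp : ∀ i, 0 ≤ p i)
    (hp1 : ∑ i, p i = 1) {t : ℝ} (ht1 : t < 1) :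
    0 < (matRpow (∑ i, (p i : ℂ) • matRpow (W i) (1 - t)) (1 / (1 - t))).trace.re := by
  have hV : ∀ i, ((p i : ℂ) • matRpow (W i) (1 - t)).PosSemidef := fun i =>
    (matRpow_posSemidef (hW i).1 _).smul (Complex.zero_le_real.mpr (hp i))
  have hA : (∑ i, (p i : ℂ) • matRpow (W i) (1 - t)).PosSemidef := posSemidef_sum _ fun i _ => hV i
  set A := ∑ i, (p i : ℂ) • matRpow (W i) (1 - t) with hAdef
  have hK := matRpow_posSemidef hA (1 / (1 - t))
  have ht2 : 1 - t ≠ 0 := by linarith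
  have hne : matRpow A (1 / (1 - t)) ≠ 0 := fun h => by
    have hA0 : A = 0 := by
      have h1 := matRpow_matRpow hA (1 / (1 - t)) (1 - t)
      rw [one_div_mul_cancel ht2, matRpow_one hA.1, h] at h1
      have h2 := matRpow_smul (A := (0 : Matrix (Fin d) (Fin d) ℂ)) PosSemidef.zero le_rfl (1 - t)
      rw [smul_zero, Real.zero_rpow ht2, Complex.ofReal_zero, zero_smul] at h2
      rw [← h1, h2]
    obtain ⟨i, -, hi⟩ : ∃ i ∈ Finset.univ, 0 < p i := by
      by_contra! hcon
      have := Finset.sum_nonpos hcon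
      linarith
    have h3 : (p i : ℂ) • matRpow (W i) (1 - t) ≤ A := by
      rw [hAdef, ← Finset.add_sum_erase _ _ (Finset.mem_univ i), le_iff_posSemidef_sub,
        add_sub_cancel_left]
      exact posSemidef_sum _ fun j _ => hV j
    rw [hA0] at h3
    have h4 := le_antisymm h3 (hV i).nonneg
    have h5 : matRpow (W i) (1 - t) = 0 :=
      (smul_eq_zero.mp h4).resolve_left (by exact_mod_cast hi.ne')
    have h6 := matRpow_matRpow (hW i).1 (1 - t) (1 / (1 - t))
    have h2 := matRpow_smul (A := (0 : Matrix (Fin d) (Fin d) ℂ)) PosSemidef.zero le_rfl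
      (1 / (1 - t))
    rw [smul_zero, Real.zero_rpow (one_div_ne_zero ht2), Complex.ofReal_zero, zero_smul] at h2
    rw [mul_one_div_cancel ht2, matRpow_one (hW i).1.1, h5, h2] at h6
    have h7 := (hW i).2
    rw [← h6, trace_zero] at h7
    exact zero_ne_one h7
  have h0 : 0 < (matRpow A (1 / (1 - t))).trace :=
    lt_of_le_of_ne hK.trace_nonneg fun h => hne (hK.trace_eq_zero_iff.mp h.symm)
  exact (Complex.pos_iff.mp h0).1

theorem trace_cqOut_const_mul_le {A : Matrix (Fin d) (Fin d) ℂ} (hA : A.PosSemidef) (i₀ : Fin k)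
    {t : ℝ} (ht : 0 ≤ t) (ht1 : t < 1) :
    (cqOut (fun _ : Fin k => A) (fun _ : Fin n => i₀) *
        matRpow (univOp d (fun _ : Fin n => i₀)) t).trace.re ≤
      (((matRpow A (1 / (1 - t))).trace.re) ^ n) ^ (1 - t) * ((n : ℝ) + 1) ^ (k * (d * d)) := by
  set K := matRpow A (1 / (1 - t)) with hK
  have hKpsd : K.PosSemidef := matRpow_posSemidef hA _
  obtain ⟨r, hr, hr'⟩ := Complex.exists_ofReal_eq_of_nonneg hKpsd.trace_nonneg
  have ht2 : 1 - t ≠ 0 := by linarith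
  have hO := univOp_posSemidef (d := d) (fun _ : Fin n => i₀)
  have h1 : cqOut (fun _ : Fin k => A) (fun _ : Fin n => i₀) =
      matRpow (cqOut (fun _ : Fin k => K) (fun _ : Fin n => i₀)) (1 - t) := by
    rw [matRpow_cqOut fun _ => hKpsd, hK, matRpow_matRpow hA, one_div_mul_cancel ht2,
      matRpow_one hA.1]
  have hcK := cqOut_posSemidef (fun _ : Fin k => hKpsd) (fun _ : Fin n => i₀)
  have h2 := (cqOut_const_isInv (n := n) K i₀).le_trace_smul_univOp hcK
  rw [trace_cqOut, Finset.prod_const, Finset.card_univ, Fintype.card_fin, ← hr',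
    ← Complex.ofReal_pow] at h2
  have h3 := matRpow_le_matRpow hcK h2 (s := 1 - t) (by linarith) (by linarith)
  rw [← h1, matRpow_smul hO (by positivity)] at h3
  have h4 := trace_mul_re_mono h3 (matRpow_posSemidef hO t)
  rw [Matrix.smul_mul, matRpow_mul_matRpow hO (by linarith) ht, sub_add_cancel, matRpow_one hO.1,
    trace_smul, smul_eq_mul, Complex.re_ofReal_mul] at h4
  rw [← hr', Complex.ofReal_re]
  exact h4.trans (mul_le_mul_of_nonneg_left (trace_univOp_le _) (by positivity))

end TypeClass

section CodeSelection

variable {k d n : ℕ}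

theorem trace_univOp_mul_testOp_comm (i₀ : Fin k) (x y : Fin n → Fin k) :
    (univOp d x * testOp d i₀ y).trace = (univOp d y * testOp d i₀ x).trace := by
  have hO := (univOp_isInv (d := d) (fun _ : Fin n => i₀)).inv
  rw [testOp, testOp, trace_mul_comm, Matrix.mul_assoc, ((hO.of_const x).commute_univOp).eq]

theorem trace_univOp_mul_testOp_nonneg (hd : 0 < d) (i₀ : Fin k) (x y : Fin n → Fin k) :
    0 ≤ (univOp d x * testOp d i₀ y).trace.re :=
  trace_mul_re_nonneg (univOp_posSemidef x) (testOp_posDef hd i₀ y).posSemidef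

theorem sum_univOp_comp_isInv (i₀ : Fin k) (x : Fin n → Fin k) :
    IsInv (fun _ => i₀) (∑ π : Equiv.Perm (Fin n), univOp d (x ∘ π)) := fun σ _ => by
  have h : ∀ π : Equiv.Perm (Fin n),
      (univOp d (x ∘ (π * σ : Equiv.Perm (Fin n)))).submatrix (permWord σ) (permWord σ) =
        univOp d (x ∘ π) := fun π => univOp_comp (x ∘ π) σ
  conv_rhs => rw [← Finset.sum_congr rfl fun π _ => h π]
  refine Eq.trans ?_ (Equiv.sum_comp (Equiv.mulRight σ) fun π : Equiv.Perm (Fin n) =>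
    (univOp d (x ∘ π)).submatrix (permWord σ) (permWord σ)).symm
  ext v w
  simp only [submatrix_apply, Matrix.sum_apply]

theorem sum_trace_univOp_mul_testOp_le (hd : 0 < d) (i₀ : Fin k) (x y : Fin n → Fin k) :
    ∑ π : Equiv.Perm (Fin n), (univOp d y * testOp d i₀ (x ∘ π)).trace.re ≤
      Fintype.card (Equiv.Perm (Fin n)) * (((n : ℝ) + 1) ^ (k * (d * d))) ^ 2 := by
  set D : ℝ := ((n : ℝ) + 1) ^ (k * (d * d)) with hD
  set S := ∑ π : Equiv.Perm (Fin n), univOp d (x ∘ π) with hS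
  have hSi : IsInv (fun _ => i₀) S := sum_univOp_comp_isInv i₀ x
  have hSp : S.PosSemidef := posSemidef_sum _ fun π _ => univOp_posSemidef _
  have hO := univOp_posDef hd (fun _ : Fin n => i₀)
  obtain ⟨r, hr, hr'⟩ := Complex.exists_ofReal_eq_of_nonneg hSp.trace_nonneg
  have hrD : r ≤ Fintype.card (Equiv.Perm (Fin n)) * D := by
    rw [← Complex.ofReal_re r, hr', hS, trace_sum, Complex.re_sum, ← nsmul_eq_mul]
    exact Finset.sum_le_card_nsmul _ _ _ fun π _ => trace_univOp_le _
  have h1 := hSi.le_trace_smul_univOp hSp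
  have hc : Commute (univOp d fun _ : Fin n => i₀) (univOp d fun _ : Fin n => i₀)⁻¹ :=
    (Commute.refl _).nonsing_inv_right hO.isUnit
  have h2 := mul_le_mul_of_commute h1 hO.inv.posSemidef
    (hSi.commute_univOp.nonsing_inv_right hO.isUnit) (hc.smul_left _)
  rw [Matrix.smul_mul, mul_nonsing_inv _ ((Matrix.isUnit_iff_isUnit_det _).mp hO.isUnit)] at h2
  have h3 := trace_mul_re_mono h2 (univOp_posSemidef (d := d) y)
  rw [← hr', Matrix.smul_mul, Matrix.one_mul, trace_smul, smul_eq_mul, Complex.re_ofReal_mul,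
    trace_mul_comm] at h3
  rw [← Complex.re_sum, ← trace_sum, ← Finset.mul_sum]
  simp only [testOp]
  rw [← Finset.sum_mul]
  refine h3.trans ?_
  have hD0 : 0 ≤ D := by positivity
  calc r * (univOp d y).trace.re ≤ r * D := mul_le_mul_of_nonneg_left (trace_univOp_le y) hr
    _ ≤ Fintype.card (Equiv.Perm (Fin n)) * D * D := mul_le_mul_of_nonneg_right hrD hD0
    _ = _ := by ring

/-- Greedy selection of a list with small total interaction. -/
theorem exists_list_sum_le {P : Type*} [Fintype P] [Nonempty P] {F : P → P → ℝ} {c : ℝ}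
    (hsymm : ∀ a b, F a b = F b a) (hF : ∀ a, ∑ b, F a b ≤ Fintype.card P * c) (hc : 0 ≤ c)
    (M : ℕ) : ∃ x : Fin M → P, ∑ i, ∑ j, (if i = j then 0 else F (x i) (x j)) ≤ (M : ℝ) ^ 2 * c := by
  induction M with
  | zero => exact ⟨Fin.elim0, by simp⟩
  | succ M ih =>
    obtain ⟨x, hx⟩ := ih
    obtain ⟨y, -, hy⟩ : ∃ y ∈ Finset.univ, ∑ i, F (x i) y ≤ M * c := by
      refine Finset.exists_le_of_sum_le Finset.univ_nonempty ?_
      rw [Finset.sum_comm, Finset.sum_const, Finset.card_univ, nsmul_eq_mul]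
      calc ∑ i, ∑ y, F (x i) y ≤ ∑ _i : Fin M, Fintype.card P * c :=
            Finset.sum_le_sum fun i _ => hF _
        _ = _ := by simp; ring
    refine ⟨Fin.cons y x, ?_⟩
    have h1 : ∑ i, F y (x i) = ∑ i, F (x i) y := Finset.sum_congr rfl fun i _ => hsymm _ _
    have h2 : ∀ i : Fin M, ¬ (0 : Fin (M + 1)) = i.succ := fun i => (Fin.succ_ne_zero i).symm
    simp only [Fin.sum_univ_succ, Fin.cons_zero, Fin.cons_succ, Fin.succ_ne_zero, if_false, if_true,
      h2, Fin.succ_inj, Finset.sum_add_distrib, zero_add, h1]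
    push_cast
    nlinarith

theorem sum_rpow_le {M : ℕ} (hM : 0 < M) (b : Fin M → ℝ) (hb : ∀ i, 0 ≤ b i) {u : ℝ} (hu : 0 ≤ u)
    (hu1 : u ≤ 1) : (1 / M : ℝ) * ∑ i, b i ^ u ≤ ((1 / M : ℝ) * ∑ i, b i) ^ u := by
  have hM' : (0 : ℝ) < M := by exact_mod_cast hM
  have := (Real.concaveOn_rpow hu hu1).le_map_sum (t := Finset.univ) (w := fun _ : Fin M => (1 / M : ℝ))
    (p := b) (fun _ _ => by positivity) (by simp [hM'.ne']) (fun i _ => hb i)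
  simpa only [smul_eq_mul, ← Finset.mul_sum] using this

end CodeSelection

section Codes

variable {k d : ℕ}

theorem exists_universal_code (hk : 0 < k) (hd : 0 < d) (p : Fin k → ℝ) (hp : ∀ i, 0 ≤ p i)
    (hp1 : ∑ i, p i = 1) (n : ℕ) {M : ℕ} (hM : 0 < M) :
    ∃ Φ : CQCode k d n, Φ.M = M ∧ ∀ W : Fin k → Matrix (Fin d) (Fin d) ℂ,
      (∀ i, (W i).PosSemidef ∧ (W i).trace = 1) → 0 < avgErr W Φ ∧
      ∀ t : ℝ, 0 ≤ t → t < 1 → avgErr W Φ ≤ Real.exp (-(n : ℝ) ^ 2) +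
        4 * ((n : ℝ) + 1) ^ (k + 5 * (k * (d * d))) *
          (Real.exp (-n * phiW W p t) ^ (1 / (1 + t)) * (M : ℝ) ^ (t / (1 + t))) := by
  set i₀ : Fin k := ⟨0, hk⟩
  have hM' : (0 : ℝ) < M := by exact_mod_cast hM
  obtain ⟨x₀, hx₀⟩ := exists_dominating_word p hp hp1 n
  set D : ℝ := ((n : ℝ) + 1) ^ (k * (d * d)) with hD
  have hn1 : (1 : ℝ) ≤ (n : ℝ) + 1 := by linarith [(Nat.cast_nonneg n : (0 : ℝ) ≤ n)]
  have hD1 : 1 ≤ D := one_le_pow₀ hn1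
  have hD0 : 0 < D := by linarith
  obtain ⟨π, hπ⟩ := exists_list_sum_le (P := Equiv.Perm (Fin n))
    (F := fun a b => (univOp d (x₀ ∘ a) * testOp d i₀ (x₀ ∘ b)).trace.re)
    (fun a b => by rw [trace_univOp_mul_testOp_comm])
    (fun a => sum_trace_univOp_mul_testOp_le hd i₀ x₀ (x₀ ∘ a)) (by positivity) M
  obtain ⟨Y, hY, hY1, hYerr⟩ := exists_universal_decoder hd i₀ hM fun i => x₀ ∘ π i
  set δ : ℝ := Real.exp (-(n : ℝ) ^ 2) with hδ
  have hδ0 : 0 < δ := Real.exp_pos _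
  have hδ1 : δ ≤ 1 := Real.exp_le_one_iff.mpr (by nlinarith)
  refine ⟨⟨M, fun i => x₀ ∘ π i, fun i => ((1 - δ : ℝ) : ℂ) • Y i,
    fun i => (hY i).smul (Complex.zero_le_real.mpr (by linarith)), ?_⟩, rfl, fun W hW => ?_⟩
  · rw [← Finset.smul_sum, hY1]
    have h1 : (1 : Matrix (Fin n → Fin d) (Fin n → Fin d) ℂ) - ((1 - δ : ℝ) : ℂ) • 1 =
        (δ : ℂ) • 1 := by
      push_cast
      module
    rw [h1]
    exact PosSemidef.one.smul (Complex.zero_le_real.mpr hδ0.le)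
  set e : Fin M → ℝ := fun i => (cqOut W (x₀ ∘ π i) * (1 - Y i)).trace.re with he
  have herr : ∀ i, (cqOut W (x₀ ∘ π i) * (1 - ((1 - δ : ℝ) : ℂ) • Y i)).trace.re =
      (1 - δ) * e i + δ := fun i => by
    have h1 : (1 : Matrix (Fin n → Fin d) (Fin n → Fin d) ℂ) - ((1 - δ : ℝ) : ℂ) • Y i =
        ((1 - δ : ℝ) : ℂ) • (1 - Y i) + (δ : ℂ) • 1 := by
      push_cast
      module
    rw [h1, Matrix.mul_add, Matrix.mul_smul, Matrix.mul_smul, Matrix.mul_one, trace_add, trace_smul,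
      trace_smul, trace_cqOut, Finset.prod_congr rfl fun j _ => (hW ((x₀ ∘ π i) j)).2,
      Finset.prod_const_one, smul_eq_mul, smul_eq_mul, mul_one, Complex.add_re,
      Complex.re_ofReal_mul, Complex.ofReal_re]
  have he0 : ∀ i, 0 ≤ e i := fun i => by
    refine trace_mul_re_nonneg (cqOut_posSemidef (fun a => (hW a).1) _) ?_
    rw [← hY1, ← Finset.add_sum_erase _ _ (Finset.mem_univ i), add_sub_cancel_left]
    exact posSemidef_sum _ fun j _ => hY j
  have hval : (1 / M : ℝ) * ∑ i, (cqOut W (x₀ ∘ π i) * (1 - ((1 - δ : ℝ) : ℂ) • Y i)).trace.re =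
      (1 - δ) * ((1 / M : ℝ) * ∑ i, e i) + δ := by
    simp only [herr, Finset.sum_add_distrib, ← Finset.mul_sum]
    simp only [Finset.sum_const, Finset.card_univ, Fintype.card_fin, nsmul_eq_mul]
    field_simp
  have hE0 : 0 ≤ (1 / M : ℝ) * ∑ i, e i :=
    mul_nonneg (by positivity) (Finset.sum_nonneg fun i _ => he0 i)
  rw [avgErr]
  change 0 < (1 / M : ℝ) * ∑ i, (cqOut W (x₀ ∘ π i) * (1 - ((1 - δ : ℝ) : ℂ) • Y i)).trace.re ∧ _
  dsimp only
  rw [hval]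
  refine ⟨by nlinarith, fun t ht ht1 => ?_⟩
  set N : ℝ := ((n : ℝ) + 1) ^ k with hN
  have hN1 : 1 ≤ N := one_le_pow₀ hn1
  set u : ℝ := t / (1 + t) with hu
  have hu0 : 0 ≤ u := by positivity
  have hu1 : u ≤ 1 := by rw [hu, div_le_one (by linarith)]; linarith
  have hv0 : 0 ≤ 1 / (1 + t) := by positivity
  have hv1 : 1 / (1 + t) ≤ 1 := by rw [div_le_one (by linarith)]; linarith
  set X : ℝ := Real.exp (-n * phiW W p t) with hX
  have hX0 : 0 < X := Real.exp_pos _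
  set h : (Fin n → Fin k) → ℝ := fun x => (cqOut (fun a => matRpow (W a) (1 - t)) x *
    matRpow (univOp d (fun _ : Fin n => i₀)) t).trace.re with hh
  have hO := univOp_posSemidef (d := d) (fun _ : Fin n => i₀)
  have hh0 : ∀ x, 0 ≤ h x := fun x => trace_mul_re_nonneg
    (cqOut_posSemidef (fun a => matRpow_posSemidef (hW a).1 _) x) (matRpow_posSemidef hO _)
  have hhinv : ∀ x (σ : Equiv.Perm (Fin n)), h (x ∘ σ) = h x := fun x σ => by
    simp only [hh]
    rw [trace_cqOut_mul_comp _ ((univOp_isInv _).matRpow hO.1 t)]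
  have ha : h x₀ ≤ N * D * X := by
    refine (hx₀ h hh0 hhinv).trans ?_
    rw [mul_assoc]
    refine mul_le_mul_of_nonneg_left ?_ (by linarith)
    have hA : (∑ i, (p i : ℂ) • matRpow (W i) (1 - t)).PosSemidef := posSemidef_sum _ fun i _ =>
      (matRpow_posSemidef (hW i).1 _).smul (Complex.zero_le_real.mpr (hp i))
    have h1 : ∑ x, (∏ j, p (x j)) * h x =
        (cqOut (fun _ : Fin k => ∑ i, (p i : ℂ) • matRpow (W i) (1 - t)) (fun _ : Fin n => i₀) *
          matRpow (univOp d (fun _ : Fin n => i₀)) t).trace.re := by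
      have h2 := sum_prod_smul_cqOut p (fun i => matRpow (W i) (1 - t)) (fun _ : Fin n => i₀)
      have h3 : cqOut (fun _ : Fin k => ∑ i, (p i : ℂ) • matRpow (W i) (1 - t))
          (fun _ : Fin n => i₀) = _ := h2.symm
      rw [h3, Finset.sum_mul, trace_sum, Complex.re_sum]
      refine Finset.sum_congr rfl fun x _ => ?_
      rw [Matrix.smul_mul, trace_smul, smul_eq_mul, Complex.re_ofReal_mul]
    rw [h1]
    refine (trace_cqOut_const_mul_le hA i₀ ht ht1).trans (le_of_eq ?_)
    have hκ := trace_matRpow_sum_pos hW p hp hp1 ht1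
    rw [mul_comm, hX, phiW, Real.rpow_def_of_pos (pow_pos hκ n), Real.log_pow]
    congr 2
    ring
  set b : Fin M → ℝ := fun i => ∑ j ∈ Finset.univ.erase i,
    (univOp d (x₀ ∘ π i) * testOp d i₀ (x₀ ∘ π j)).trace.re with hb
  have hb0 : ∀ i, 0 ≤ b i := fun i =>
    Finset.sum_nonneg fun j _ => trace_univOp_mul_testOp_nonneg hd i₀ _ _
  have hbsum : ∑ i, b i ≤ (M : ℝ) ^ 2 * D ^ 2 := by
    refine le_trans (le_of_eq ?_) hπ
    refine Finset.sum_congr rfl fun i _ => ?_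
    rw [hb, ← Finset.add_sum_erase _ _ (Finset.mem_univ i), if_pos rfl, zero_add]
    exact Finset.sum_congr rfl fun j hj => (if_neg (Finset.ne_of_mem_erase hj).symm).symm
  have hbM : (1 / M : ℝ) * ∑ i, 4 * b i ≤ 4 * D ^ 2 * M := by
    rw [← Finset.mul_sum, one_div, inv_mul_le_iff₀ hM']
    nlinarith
  have hterm : ∀ i, e i ≤ D ^ 2 * ((N * D * X) ^ (1 / (1 + t)) * (4 * b i) ^ u) := fun i => by
    refine (hYerr W hW t ht ht1 i).trans ?_
    refine mul_le_mul_of_nonneg_left (mul_le_mul_of_nonneg_right ?_ ?_) (by positivity)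
    · refine Real.rpow_le_rpow (hh0 _) ?_ hv0
      exact (hhinv x₀ (π i)).le.trans ha
    · exact Real.rpow_nonneg (mul_nonneg (by norm_num) (hb0 i)) _
  have hE : (1 / M : ℝ) * ∑ i, e i ≤
      D ^ 2 * ((N * D * X) ^ (1 / (1 + t)) * (4 * D ^ 2 * M) ^ u) := by
    calc (1 / M : ℝ) * ∑ i, e i
        ≤ (1 / M : ℝ) * ∑ i, D ^ 2 * ((N * D * X) ^ (1 / (1 + t)) * (4 * b i) ^ u) :=
          mul_le_mul_of_nonneg_left (Finset.sum_le_sum fun i _ => hterm i) (by positivity)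
      _ = D ^ 2 * ((N * D * X) ^ (1 / (1 + t)) * ((1 / M : ℝ) * ∑ i, (4 * b i) ^ u)) := by
          rw [← Finset.mul_sum, ← Finset.mul_sum]; ring
      _ ≤ D ^ 2 * ((N * D * X) ^ (1 / (1 + t)) * ((1 / M : ℝ) * ∑ i, 4 * b i) ^ u) := by
          gcongr
          exact sum_rpow_le hM _ (fun i => mul_nonneg (by norm_num) (hb0 i)) hu0 hu1
      _ ≤ _ := by
          refine mul_le_mul_of_nonneg_left (mul_le_mul_of_nonneg_left ?_ (by positivity))
            (by positivity)
          exact Real.rpow_le_rpow (mul_nonneg (by positivity)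
            (Finset.sum_nonneg fun i _ => mul_nonneg (by norm_num) (hb0 i))) hbM hu0
  have h1 : (N * D * X) ^ (1 / (1 + t)) ≤ N * D * X ^ (1 / (1 + t)) := by
    rw [Real.mul_rpow (by positivity) hX0.le]
    exact mul_le_mul_of_nonneg_right
      (Real.rpow_le_self_of_one_le (by nlinarith) hv1) (by positivity)
  have h2 : (4 * D ^ 2 * M) ^ u ≤ 4 * D ^ 2 * (M : ℝ) ^ u := by
    rw [Real.mul_rpow (by positivity) hM'.le]
    exact mul_le_mul_of_nonneg_right
      (Real.rpow_le_self_of_one_le (by nlinarith) hu1) (by positivity)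
  have h3 : (1 / M : ℝ) * ∑ i, e i ≤ 4 * ((n : ℝ) + 1) ^ (k + 5 * (k * (d * d))) *
      (X ^ (1 / (1 + t)) * (M : ℝ) ^ u) := by
    calc (1 / M : ℝ) * ∑ i, e i ≤ D ^ 2 * ((N * D * X ^ (1 / (1 + t))) * (4 * D ^ 2 * (M : ℝ) ^ u)) :=
          hE.trans (by gcongr)
      _ = _ := by
          rw [pow_add, mul_comm 5, pow_mul, ← hD, ← hN]
          ring
  nlinarith

end Codes

section Asymptotics

theorem tendsto_exp_neg_sq_add (L : ℕ) (a : ℝ) {ε : ℝ} (hε : 0 < ε) :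
    Tendsto (fun n : ℕ => Real.exp (n * (a - n)) + 8 * ((n : ℝ) + 1) ^ L * Real.exp (-(ε * n)))
      atTop (nhds 0) := by
  have h1 : Tendsto (fun n : ℕ => Real.exp (n * (a - n))) atTop (nhds 0) := by
    refine Real.tendsto_exp_atBot.comp ?_
    refine (tendsto_natCast_atTop_atTop (R := ℝ)).atTop_mul_atBot₀ ?_
    exact tendsto_const_nhds.add_atBot
      (tendsto_neg_atTop_atBot.comp (tendsto_natCast_atTop_atTop (R := ℝ)))
  have h2 := ((tendsto_pow_const_mul_const_pow_of_abs_lt_one L (r := Real.exp (-ε)) (by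
    rw [abs_of_pos (Real.exp_pos _)]
    exact Real.exp_lt_one_iff.mpr (by linarith))).comp (tendsto_add_atTop_nat 1)).const_mul
      (8 * Real.exp ε)
  rw [mul_zero] at h2
  have h3 := h1.add h2
  rw [add_zero] at h3
  refine h3.congr fun n => ?_
  simp only [Function.comp_apply]
  rw [← Real.exp_nat_mul]
  have h4 : Real.exp (-(ε * n)) = Real.exp ε * Real.exp ((n + 1 : ℕ) * -ε) := by
    rw [← Real.exp_add]
    congr 1
    push_cast
    ring
  rw [h4]
  push_cast
  ring

theorem coe_le_liminf_neg_log_div {e : ℕ → ℝ} {L : ℕ} {E : ℝ} (he0 : ∀ n, 0 < e n)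
    (he : ∀ n : ℕ, e n ≤ Real.exp (-(n : ℝ) ^ 2) +
      8 * ((n : ℝ) + 1) ^ L * Real.exp (-(n * E))) :
    (E : EReal) ≤ liminf (fun n : ℕ => (((-1 : ℝ) / n) * Real.log (e n) : EReal)) atTop := by
  refine EReal.ge_of_forall_gt_iff_ge.mp fun z hz => ?_
  have hzE : z < E := by exact_mod_cast hz
  refine le_liminf_of_le (h := ?_)
  have h1 := (tendsto_exp_neg_sq_add L z (sub_pos.mpr hzE)).eventually (gt_mem_nhds one_pos)
  filter_upwards [h1, eventually_gt_atTop 0] with n hn hn0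
  have hn0' : (0 : ℝ) < n := by exact_mod_cast hn0
  have h2 : e n ≤ Real.exp (-(n * z)) := by
    have h3 : Real.exp (-(n : ℝ) ^ 2) = Real.exp (-(n * z)) * Real.exp (n * (z - n)) := by
      rw [← Real.exp_add]; congr 1; ring
    have h4 : Real.exp (-(n * E)) = Real.exp (-(n * z)) * Real.exp (-((E - z) * n)) := by
      rw [← Real.exp_add]; congr 1; ring
    have h5 := he n
    rw [h3, h4] at h5
    nlinarith [Real.exp_pos (-(n * z))]
  have h3 : Real.log (e n) ≤ -(n * z) := by
    rw [← Real.log_exp (-(n * z))]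
    exact Real.log_le_log (he0 n) h2
  have h4 : z ≤ (-1 : ℝ) / n * Real.log (e n) := by
    rw [div_mul_eq_mul_div, le_div_iff₀ hn0']
    linarith
  have h5 : (((-1 : ℝ) / n) * Real.log (e n) : EReal) =
      (((-1 : ℝ) / n * Real.log (e n) : ℝ) : EReal) := by
    rw [EReal.coe_mul, EReal.coe_div]
    rfl
  rw [h5]
  exact_mod_cast h4

theorem tendsto_log_ceil_exp (R : ℝ) (hR : 0 < R) :
    Tendsto (fun n : ℕ => (1 / n : ℝ) * Real.log (⌈Real.exp (n * R)⌉₊ : ℝ)) atTop (nhds R) := by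
  have h1 : Tendsto (fun n : ℕ => Real.log 2 / (n : ℝ) + R) atTop (nhds R) := by
    simpa using (tendsto_const_div_atTop_nhds_zero_nat (Real.log 2)).add_const R
  refine tendsto_of_tendsto_of_tendsto_of_le_of_le' tendsto_const_nhds h1 ?_ ?_
  all_goals
    filter_upwards [eventually_gt_atTop 0] with n hn
    have hn0 : (0 : ℝ) < n := by exact_mod_cast hn
    have hpos := Real.exp_pos (n * R)
    have hle := Nat.le_ceil (Real.exp (n * R))
  · rw [one_div, ← div_eq_inv_mul, le_div_iff₀ hn0, mul_comm]
    calc n * R = Real.log (Real.exp (n * R)) := (Real.log_exp _).symm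
      _ ≤ _ := Real.log_le_log hpos hle
  · have h3 : (⌈Real.exp (n * R)⌉₊ : ℝ) ≤ 2 * Real.exp (n * R) := by
      have := Nat.ceil_lt_add_one hpos.le
      have := Real.one_le_exp (by positivity : 0 ≤ n * R)
      linarith
    have h4 := Real.log_le_log (hpos.trans_le hle) h3
    rw [Real.log_mul two_ne_zero hpos.ne', Real.log_exp] at h4
    rw [one_div, ← div_eq_inv_mul, div_le_iff₀ hn0, add_mul, div_mul_cancel₀ _ hn0.ne']
    linarith

end Asymptotics

end Helpers

/-- Universal coding for classical-quantum channels: for every probability vector `p` on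
`{1,…,k}` and every rate `R > 0` there is a sequence of codes, independent of the channel,
whose size grows at rate `R` and whose error decays, for every channel `W`, at exponential
rate at least `sup_{0 ≤ t < 1} (φ_{W,p}(t) - tR)/(1+t)`. -/
theorem universal_coding (k d : ℕ) (hk : 0 < k) (hd : 0 < d)
    (p : Fin k → ℝ) (hp : ∀ i, 0 ≤ p i) (hp1 : ∑ i, p i = 1)
    (R : ℝ) (hR : 0 < R) :
    ∃ Φ : (n : ℕ) → CQCode k d n,
      Tendsto (fun n : ℕ => (1 / n : ℝ) * Real.log ((Φ n).M)) atTop (nhds R) ∧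
      ∀ W : Fin k → Matrix (Fin d) (Fin d) ℂ,
        (∀ i, (W i).PosSemidef ∧ (W i).trace = 1) →
        (⨆ t : Set.Ico (0 : ℝ) 1,
            (((phiW W p t.1 - t.1 * R) / (1 + t.1) : ℝ) : EReal)) ≤
          Filter.liminf
            (fun n : ℕ => (((-1 : ℝ) / n) * Real.log (avgErr W (Φ n)) : EReal))
            atTop := by
  have hM : ∀ n : ℕ, 0 < ⌈Real.exp (n * R)⌉₊ := fun n => Nat.ceil_pos.mpr (Real.exp_pos _)
  choose Φ hΦM hΦ using fun n : ℕ => exists_universal_code hk hd p hp hp1 n (hM n)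
  refine ⟨Φ, ?_, fun W hW => iSup_le fun ⟨t, ht, ht1⟩ => ?_⟩
  · simp only [hΦM]
    exact tendsto_log_ceil_exp R hR
  · refine coe_le_liminf_neg_log_div (L := k + 5 * (k * (d * d))) (fun n => (hΦ n W hW).1)
      fun n => ((hΦ n W hW).2 t ht ht1).trans ?_
    have hn0 : (0 : ℝ) ≤ n := Nat.cast_nonneg n
    have hu0 : 0 ≤ t / (1 + t) := by positivity
    have hu1 : t / (1 + t) ≤ 1 := by rw [div_le_one (by linarith)]; linarith
    have h1 : (⌈Real.exp (n * R)⌉₊ : ℝ) ≤ 2 * Real.exp (n * R) := by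
      have := Nat.ceil_lt_add_one (Real.exp_pos (n * R)).le
      have := Real.one_le_exp (by positivity : 0 ≤ n * R)
      linarith
    have h2 : (⌈Real.exp (n * R)⌉₊ : ℝ) ^ (t / (1 + t)) ≤
        2 * Real.exp (n * R * (t / (1 + t))) := by
      refine (Real.rpow_le_rpow (Nat.cast_nonneg _) h1 hu0).trans ?_
      rw [Real.mul_rpow (by norm_num) (Real.exp_pos _).le, ← Real.exp_mul]
      exact mul_le_mul_of_nonneg_right
        (Real.rpow_le_self_of_one_le (by norm_num) hu1) (Real.exp_pos _).le
    have h3 : Real.exp (-n * phiW W p t) ^ (1 / (1 + t)) *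
        (⌈Real.exp (n * R)⌉₊ : ℝ) ^ (t / (1 + t)) ≤
          2 * Real.exp (-(n * ((phiW W p t - t * R) / (1 + t)))) := by
      rw [← Real.exp_mul]
      refine (mul_le_mul_of_nonneg_left h2 (Real.exp_pos _).le).trans (le_of_eq ?_)
      rw [mul_left_comm, ← Real.exp_add]
      congr 2
      field_simp
      ring
    have h4 := mul_le_mul_of_nonneg_left h3
      (by positivity : 0 ≤ 4 * ((n : ℝ) + 1) ^ (k + 5 * (k * (d * d))))
    linarith
end

section
/- Let X be a d×d positive semidefinite complex matrix and let t ∈ (0,1). Then the supremum over all d×d density matrices σ of Tr[X σ^t] equals (Tr[X^{1/(1−t)}])^{1−t}, and this supremum is attained. -/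
open Matrix
open scoped ComplexOrder

namespace Matrix

variable {ι : Type*} [Fintype ι] [DecidableEq ι]

theorem IsHermitian.cfc_eq_mul {A : Matrix ι ι ℂ} (hA : A.IsHermitian) (f : ℝ → ℝ) :
    cfc f A = (hA.eigenvectorUnitary : Matrix ι ι ℂ) *
      Matrix.diagonal (fun i => ((f (hA.eigenvalues i) : ℝ) : ℂ)) *
      star (hA.eigenvectorUnitary : Matrix ι ι ℂ) := by
  rw [hA.cfc_eq, IsHermitian.cfc, Unitary.conjStarAlgAut_apply]
  rfl

theorem IsHermitian.matRpow_eq_cfc {A : Matrix ι ι ℂ} (hA : A.IsHermitian) (s : ℝ) :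
    matRpow A s = cfc (fun x : ℝ => x ^ s) A := by
  rw [hA.cfc_eq_mul, matRpow, dif_pos hA]

theorem IsHermitian.trace_cfc {A : Matrix ι ι ℂ} (hA : A.IsHermitian) (f : ℝ → ℝ) :
    (cfc f A).trace = ((∑ i, f (hA.eigenvalues i) : ℝ) : ℂ) := by
  rw [hA.cfc_eq_mul, trace_mul_cycle, Unitary.coe_star_mul_self, one_mul, trace_diagonal,
    Complex.ofReal_sum]

theorem IsHermitian.posSemidef_cfc {A : Matrix ι ι ℂ} (hA : A.IsHermitian) {f : ℝ → ℝ}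
    (hf : ∀ i, 0 ≤ f (hA.eigenvalues i)) : (cfc f A).PosSemidef := by
  rw [hA.cfc_eq_mul]
  refine PosSemidef.mul_mul_conjTranspose_same (posSemidef_diagonal_iff.2 fun i => ?_) _
  exact_mod_cast hf i

/-- The squared moduli of the inner products of the eigenvectors of two Hermitian matrices. -/
noncomputable def eigenvectorOverlap {A B : Matrix ι ι ℂ} (hA : A.IsHermitian)
    (hB : B.IsHermitian) (i j : ι) : ℝ :=
  Complex.normSq ((star (hA.eigenvectorUnitary : Matrix ι ι ℂ) *
    (hB.eigenvectorUnitary : Matrix ι ι ℂ)) i j)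

theorem trace_cfc_mul_cfc {A B : Matrix ι ι ℂ} (hA : A.IsHermitian) (hB : B.IsHermitian)
    (f g : ℝ → ℝ) :
    (cfc f A * cfc g B).trace = ((∑ i, ∑ j, f (hA.eigenvalues i) * g (hB.eigenvalues j) *
      eigenvectorOverlap hA hB i j : ℝ) : ℂ) := by
  rw [hA.cfc_eq_mul, hB.cfc_eq_mul]
  set U := (hA.eigenvectorUnitary : Matrix ι ι ℂ) with hU
  set V := (hB.eigenvectorUnitary : Matrix ι ι ℂ) with hV
  set D := diagonal (fun i => ((f (hA.eigenvalues i) : ℝ) : ℂ)) with hD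
  set E := diagonal (fun i => ((g (hB.eigenvalues i) : ℝ) : ℂ)) with hE
  have h : (U * D * star U * (V * E * star V)).trace
      = (D * (star U * V) * E * star (star U * V)).trace := by
    rw [star_mul, star_star, mul_assoc U D, mul_assoc U, trace_mul_comm]
    simp only [mul_assoc]
  rw [h, trace]
  push_cast
  refine Finset.sum_congr rfl fun i _ => ?_
  rw [diag_apply, mul_apply]
  refine Finset.sum_congr rfl fun j _ => ?_
  rw [hE, mul_diagonal, hD, diagonal_mul, star_apply, eigenvectorOverlap, ← hU, ← hV,
    Complex.normSq_eq_conj_mul_self]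
  simp only [RCLike.star_def]
  ring

theorem eigenvectorOverlap_nonneg {A B : Matrix ι ι ℂ} (hA : A.IsHermitian)
    (hB : B.IsHermitian) (i j : ι) : 0 ≤ eigenvectorOverlap hA hB i j :=
  Complex.normSq_nonneg _

theorem sum_normSq_row_of_mul_star {W : Matrix ι ι ℂ} (hW : W * star W = 1) (i : ι) :
    ∑ j, Complex.normSq (W i j) = 1 := by
  have h := congr_fun (congr_fun hW i) i
  rw [mul_apply, one_apply_eq] at h
  simp only [star_apply, RCLike.star_def, Complex.mul_conj] at h
  exact_mod_cast h

theorem sum_eigenvectorOverlap_right {A B : Matrix ι ι ℂ} (hA : A.IsHermitian)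
    (hB : B.IsHermitian) (i : ι) : ∑ j, eigenvectorOverlap hA hB i j = 1 :=
  sum_normSq_row_of_mul_star
    (Unitary.mul_star_self_of_mem (star hA.eigenvectorUnitary * hB.eigenvectorUnitary).2) i

theorem eigenvectorOverlap_comm {A B : Matrix ι ι ℂ} (hA : A.IsHermitian)
    (hB : B.IsHermitian) (i j : ι) :
    eigenvectorOverlap hA hB i j = eigenvectorOverlap hB hA j i := by
  rw [eigenvectorOverlap, eigenvectorOverlap, ← Complex.normSq_conj]
  congr 1
  rw [← RCLike.star_def, ← star_apply, star_mul, star_star]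

theorem sum_eigenvectorOverlap_left {A B : Matrix ι ι ℂ} (hA : A.IsHermitian)
    (hB : B.IsHermitian) (j : ι) : ∑ i, eigenvectorOverlap hA hB i j = 1 := by
  simp_rw [eigenvectorOverlap_comm hA hB]
  exact sum_eigenvectorOverlap_right hB hA j

end Matrix

/-- Hölder's inequality for a doubly stochastic array of weights. -/
theorem sum_mul_rpow_mul_le_of_doublyStochastic {ι κ : Type*} [Fintype ι] [Fintype κ]
    {W : ι → κ → ℝ} (hW : ∀ i j, 0 ≤ W i j) (hrow : ∀ i, ∑ j, W i j = 1)
    (hcol : ∀ j, ∑ i, W i j = 1) {x : ι → ℝ} (hx : ∀ i, 0 ≤ x i) {s : κ → ℝ}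
    (hs : ∀ j, 0 ≤ s j) {t : ℝ} (ht0 : 0 < t) (ht1 : t < 1) :
    ∑ i, ∑ j, x i * s j ^ t * W i j ≤
      (∑ i, x i ^ (1 / (1 - t))) ^ (1 - t) * (∑ j, s j) ^ t := by
  have ht : 0 < 1 - t := sub_pos.2 ht1
  have hpq : (1 / (1 - t)).HolderConjugate (1 / t) := by
    rw [Real.holderConjugate_iff]
    refine ⟨(one_lt_div ht).2 (by linarith), by simp⟩
  have h := Real.inner_le_Lp_mul_Lq_of_nonneg (Finset.univ : Finset (ι × κ))
    (f := fun p => x p.1 * W p.1 p.2 ^ (1 - t)) (g := fun p => s p.2 ^ t * W p.1 p.2 ^ t) hpq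
    (fun p _ => mul_nonneg (hx _) (Real.rpow_nonneg (hW _ _) _))
    (fun p _ => mul_nonneg (Real.rpow_nonneg (hs _) _) (Real.rpow_nonneg (hW _ _) _))
  simp only [one_div_one_div, Fintype.sum_prod_type] at h
  have h1 : ∀ i j, x i * W i j ^ (1 - t) * (s j ^ t * W i j ^ t) = x i * s j ^ t * W i j := by
    intro i j
    have : W i j ^ (1 - t) * W i j ^ t = W i j := by
      rw [← Real.rpow_add_of_nonneg (hW i j) ht.le ht0.le, sub_add_cancel, Real.rpow_one]
    linear_combination x i * s j ^ t * this
  have h2 : ∀ i j, (x i * W i j ^ (1 - t)) ^ (1 / (1 - t)) = x i ^ (1 / (1 - t)) * W i j := by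
    intro i j
    rw [Real.mul_rpow (hx i) (Real.rpow_nonneg (hW i j) _), ← Real.rpow_mul (hW i j),
      mul_one_div_cancel ht.ne', Real.rpow_one]
  have h3 : ∀ i j, (s j ^ t * W i j ^ t) ^ (1 / t) = s j * W i j := by
    intro i j
    rw [← Real.mul_rpow (hs j) (hW i j), ← Real.rpow_mul (mul_nonneg (hs j) (hW i j)),
      mul_one_div_cancel ht0.ne', Real.rpow_one]
  simp only [h1, h2, h3] at h
  rw [Finset.sum_comm (f := fun i j => s j * W i j)] at h
  simpa only [← Finset.mul_sum, hrow, hcol, mul_one] using h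

/-- The density matrix `X ^ (1 / (1 - t)) / Tr[X ^ (1 / (1 - t))]` attains the value
`(Tr[X ^ (1 / (1 - t))]) ^ (1 - t)`. -/
theorem Matrix.PosSemidef.exists_trace_mul_matRpow_eq {ι : Type*} [Fintype ι] [DecidableEq ι]
    [Nonempty ι] {X : Matrix ι ι ℂ} (hX : X.PosSemidef) {t : ℝ} (ht0 : 0 < t) (ht1 : t < 1) :
    ∃ σ : Matrix ι ι ℂ, σ.PosSemidef ∧ σ.trace = 1 ∧
      (∑ i, hX.isHermitian.eigenvalues i ^ (1 / (1 - t))) ^ (1 - t) =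
        ((X * matRpow σ t).trace).re := by
  have ht : 0 < 1 - t := sub_pos.2 ht1
  have hp : 0 < 1 / (1 - t) := one_div_pos.2 ht
  set hH := hX.isHermitian
  have hx : ∀ i, 0 ≤ hH.eigenvalues i := hX.eigenvalues_nonneg
  set T := ∑ i, hH.eigenvalues i ^ (1 / (1 - t)) with hT
  have hT0 : 0 ≤ T := Finset.sum_nonneg fun i _ => Real.rpow_nonneg (hx i) _
  rcases hT0.eq_or_lt with hT0 | hT0
  · have hX0 : X = 0 := by
      rw [← hH.eigenvalues_eq_zero_iff]
      funext i
      have := (Finset.sum_eq_zero_iff_of_nonneg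
        (fun i _ => Real.rpow_nonneg (hx i) (1 / (1 - t)))).1 hT0.symm i (Finset.mem_univ i)
      exact (Real.rpow_eq_zero (hx i) hp.ne').1 this
    refine ⟨cfc (fun _ : ℝ => (Fintype.card ι : ℝ)⁻¹) X,
      hH.posSemidef_cfc fun _ => by positivity, ?_, ?_⟩
    · rw [hH.trace_cfc]
      simp
    · rw [← hT0, Real.zero_rpow ht.ne', hX0]
      simp
  · have hcont : ∀ f : ℝ → ℝ, ContinuousOn f (spectrum ℝ X) :=
      fun f => X.finite_real_spectrum.continuousOn f
    have hσ : (cfc (fun x : ℝ => x ^ (1 / (1 - t)) / T) X).PosSemidef :=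
      hH.posSemidef_cfc fun i => div_nonneg (Real.rpow_nonneg (hx i) _) hT0.le
    refine ⟨cfc (fun x : ℝ => x ^ (1 / (1 - t)) / T) X, hσ, ?_, ?_⟩
    · rw [hH.trace_cfc, ← Finset.sum_div, ← hT, div_self hT0.ne', Complex.ofReal_one]
    · have hcomp : X * matRpow (cfc (fun x : ℝ => x ^ (1 / (1 - t)) / T) X) t
          = cfc (fun x : ℝ => x * (x ^ (1 / (1 - t)) / T) ^ t) X := by
        rw [hσ.isHermitian.matRpow_eq_cfc,
          ← cfc_comp' (fun x : ℝ => x ^ t) (fun x : ℝ => x ^ (1 / (1 - t)) / T) X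
            ((X.finite_real_spectrum.image _).continuousOn _) (hcont _) hH.isSelfAdjoint,
          cfc_mul (fun x : ℝ => x) (fun x : ℝ => (x ^ (1 / (1 - t)) / T) ^ t) X
            (hcont _) (hcont _), cfc_id' ℝ X hH.isSelfAdjoint]
      have hterm : ∀ i, hH.eigenvalues i * (hH.eigenvalues i ^ (1 / (1 - t)) / T) ^ t
          = hH.eigenvalues i ^ (1 / (1 - t)) / T ^ t := by
        intro i
        have hexp : 1 + 1 / (1 - t) * t = 1 / (1 - t) := by
          field_simp
          ring
        rw [Real.div_rpow (Real.rpow_nonneg (hx i) _) hT0.le, ← Real.rpow_mul (hx i),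
          ← mul_div_assoc]
        nth_rewrite 1 [← Real.rpow_one (hH.eigenvalues i)]
        rw [← Real.rpow_add_of_nonneg (hx i) zero_le_one (mul_nonneg hp.le ht0.le), hexp]
      rw [hcomp, hH.trace_cfc, Complex.ofReal_re, Finset.sum_congr rfl fun i _ => hterm i,
        ← Finset.sum_div, ← hT, Real.rpow_sub hT0, Real.rpow_one]

/-- For `0 < t < 1`, `Tr[X σ ^ t] ≤ (Tr[X ^ (1 / (1 - t))]) ^ (1 - t) * (Tr σ) ^ t`, in terms of
the eigenvalues of `X` and `σ`. -/
theorem Matrix.PosSemidef.re_trace_mul_matRpow_le {ι : Type*} [Fintype ι] [DecidableEq ι]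
    {X σ : Matrix ι ι ℂ} (hX : X.PosSemidef) (hσ : σ.PosSemidef) {t : ℝ} (ht0 : 0 < t)
    (ht1 : t < 1) :
    ((X * matRpow σ t).trace).re ≤
      (∑ i, hX.isHermitian.eigenvalues i ^ (1 / (1 - t))) ^ (1 - t) *
        (∑ i, hσ.isHermitian.eigenvalues i) ^ t := by
  have h := trace_cfc_mul_cfc hX.isHermitian hσ.isHermitian (fun x => x) (fun x => x ^ t)
  rw [cfc_id' ℝ X hX.isHermitian.isSelfAdjoint, ← hσ.isHermitian.matRpow_eq_cfc] at h
  rw [h, Complex.ofReal_re]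
  exact sum_mul_rpow_mul_le_of_doublyStochastic (eigenvectorOverlap_nonneg _ _)
    (sum_eigenvectorOverlap_right _ _) (sum_eigenvectorOverlap_left _ _)
    hX.eigenvalues_nonneg hσ.eigenvalues_nonneg ht0 ht1

/-- For a `d × d` positive semidefinite matrix `X` and `t ∈ (0,1)`, the supremum of
`Tr[X σ^t]` over density matrices `σ` equals `(Tr[X^{1/(1-t)}])^{1-t}`, and is attained. -/
theorem sup_trace_pow (d : ℕ) (hd : 0 < d) (X : Matrix (Fin d) (Fin d) ℂ)
    (hX : X.PosSemidef) (t : ℝ) (ht : t ∈ Set.Ioo (0 : ℝ) 1) :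
    IsGreatest
      {y : ℝ | ∃ σ : Matrix (Fin d) (Fin d) ℂ,
        σ.PosSemidef ∧ σ.trace = 1 ∧ y = ((X * matRpow σ t).trace).re}
      (((matRpow X (1 / (1 - t))).trace.re) ^ (1 - t)) := by
  have : Nonempty (Fin d) := ⟨⟨0, hd⟩⟩
  rw [hX.isHermitian.matRpow_eq_cfc, hX.isHermitian.trace_cfc, Complex.ofReal_re]
  refine ⟨hX.exists_trace_mul_matRpow_eq ht.1 ht.2, ?_⟩
  rintro y ⟨σ, hσ, hσ1, rfl⟩
  have hsum : ∑ i, hσ.isHermitian.eigenvalues i = 1 := by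
    have h := hσ.isHermitian.trace_eq_sum_eigenvalues
    rw [hσ1] at h
    simpa using (congrArg Complex.re h).symm
  simpa only [hsum, Real.one_rpow, mul_one] using
    hX.re_trace_mul_matRpow_le hσ ht.1 ht.2
end

section
/- Let W be a classical-quantum channel with input alphabet X = {1,…,k} and output dimension d such that each W(i) is positive definite, let p be a probability vector on X, and let R be a real number with R < I(p,W) := ∑_{i=1}^k p_i Tr[W(i)(log W(i) − log W_p)], where W_p := ∑_i p_i W(i). Then there exists t ∈ (0,1) with φ_{W,p}(t) − tR > 0; consequently sup_{0≤t<1} (φ_{W,p}(t) − tR)/(1+t) > 0. -/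
open Matrix
open scoped ComplexOrder

open Classical in
/-- The matrix logarithm of a positive definite (more generally Hermitian) matrix, via
the spectral decomposition. -/
noncomputable def matLog {ι : Type*} [Fintype ι] [DecidableEq ι]
    (A : Matrix ι ι ℂ) : Matrix ι ι ℂ :=
  if hA : A.IsHermitian then
    (hA.eigenvectorUnitary : Matrix ι ι ℂ) *
      Matrix.diagonal (fun i => ((Real.log (hA.eigenvalues i) : ℝ) : ℂ)) *
      star (hA.eigenvectorUnitary : Matrix ι ι ℂ)
  else 0

/-- The Hermitian matrix with eigenvector matrix `U` and real eigenvalues `D`. -/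
noncomputable def specMat {ι : Type*} [Fintype ι] [DecidableEq ι]
    (U : unitaryGroup ι ℂ) (D : ι → ℝ) : Matrix ι ι ℂ :=
  (U : Matrix ι ι ℂ) * diagonal (fun i => (D i : ℂ)) * star (U : Matrix ι ι ℂ)

section specMat

variable {ι : Type*} [Fintype ι] [DecidableEq ι]

lemma specMat_isHermitian (U : unitaryGroup ι ℂ) (D : ι → ℝ) : (specMat U D).IsHermitian := by
  have h : (diagonal (fun i => (D i : ℂ)))ᴴ = diagonal (fun i => (D i : ℂ)) := by
    rw [diagonal_conjTranspose]
    congr 1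
    ext i
    simp
  simp only [specMat, Matrix.IsHermitian, star_eq_conjTranspose, conjTranspose_mul,
    conjTranspose_conjTranspose, h, Matrix.mul_assoc]

lemma specMat_mul_specMat (U : unitaryGroup ι ℂ) (D E : ι → ℝ) :
    specMat U D * specMat U E = specMat U (fun i => D i * E i) := by
  have hU : star (U : Matrix ι ι ℂ) * (U : Matrix ι ι ℂ) = 1 := Unitary.coe_star_mul_self U
  calc specMat U D * specMat U E
      = (U : Matrix ι ι ℂ) * diagonal (fun i => (D i : ℂ)) *
          (star (U : Matrix ι ι ℂ) * (U : Matrix ι ι ℂ)) *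
          diagonal (fun i => (E i : ℂ)) * star (U : Matrix ι ι ℂ) := by
        simp only [specMat, Matrix.mul_assoc]
    _ = specMat U (fun i => D i * E i) := by
        rw [hU, Matrix.mul_one, Matrix.mul_assoc (U : Matrix ι ι ℂ), diagonal_mul_diagonal]
        simp [specMat]

lemma trace_unitary_conj (U : unitaryGroup ι ℂ) (A : Matrix ι ι ℂ) :
    (star (U : Matrix ι ι ℂ) * A * (U : Matrix ι ι ℂ)).trace = A.trace := by
  have hU : (U : Matrix ι ι ℂ) * star (U : Matrix ι ι ℂ) = 1 := Unitary.coe_mul_star_self U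
  rw [Matrix.trace_mul_comm, ← Matrix.mul_assoc, hU, Matrix.one_mul]

lemma trace_specMat_re (U : unitaryGroup ι ℂ) (D : ι → ℝ) :
    (specMat U D).trace.re = ∑ i, D i := by
  have hU : star (U : Matrix ι ι ℂ) * (U : Matrix ι ι ℂ) = 1 := Unitary.coe_star_mul_self U
  rw [specMat, Matrix.trace_mul_comm, ← Matrix.mul_assoc, hU, Matrix.one_mul, trace_diagonal]
  simp

lemma eq_specMat {A : Matrix ι ι ℂ} (hA : A.IsHermitian) :
    A = specMat hA.eigenvectorUnitary hA.eigenvalues := by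
  conv_lhs => rw [hA.spectral_theorem]
  rw [Unitary.conjStarAlgAut_apply]
  rfl

lemma matRpow_eq_specMat {A : Matrix ι ι ℂ} (hA : A.IsHermitian) (s : ℝ) :
    matRpow A s = specMat hA.eigenvectorUnitary (fun i => hA.eigenvalues i ^ s) := by
  rw [matRpow, dif_pos hA, specMat]

lemma matLog_eq_specMat {A : Matrix ι ι ℂ} (hA : A.IsHermitian) :
    matLog A = specMat hA.eigenvectorUnitary (fun i => Real.log (hA.eigenvalues i)) := by
  rw [matLog, dif_pos hA, specMat]

lemma matRpow_isHermitian {A : Matrix ι ι ℂ} (hA : A.IsHermitian) (s : ℝ) :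
    (matRpow A s).IsHermitian := by
  rw [matRpow_eq_specMat hA]
  exact specMat_isHermitian _ _

lemma trace_mul_matLog_re {A : Matrix ι ι ℂ} (hA : A.IsHermitian) :
    (A * matLog A).trace.re = ∑ i, hA.eigenvalues i * Real.log (hA.eigenvalues i) := by
  conv_lhs => rw [matLog_eq_specMat hA]; enter [1, 1, 1]; rw [eq_specMat hA]
  rw [specMat_mul_specMat, trace_specMat_re]

lemma trace_matRpow_re {A : Matrix ι ι ℂ} (hA : A.IsHermitian) (s : ℝ) :
    (matRpow A s).trace.re = ∑ i, hA.eigenvalues i ^ s := by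
  rw [matRpow_eq_specMat hA, trace_specMat_re]

lemma trace_re_eq_sum_eigenvalues {A : Matrix ι ι ℂ} (hA : A.IsHermitian) :
    A.trace.re = ∑ i, hA.eigenvalues i := by
  conv_lhs => rw [eq_specMat hA]
  rw [trace_specMat_re]

/-- The real part of the `l`-th diagonal entry of `A` in the basis given by the columns of `U`. -/
noncomputable def diagEntry (U : unitaryGroup ι ℂ) (l : ι) (A : Matrix ι ι ℂ) : ℝ :=
  ((star (U : Matrix ι ι ℂ) * A * (U : Matrix ι ι ℂ)) l l).re

lemma sum_diagEntry (U : unitaryGroup ι ℂ) (A : Matrix ι ι ℂ) :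
    ∑ l, diagEntry U l A = A.trace.re := by
  rw [← trace_unitary_conj U A, Matrix.trace, Complex.re_sum]
  rfl

lemma diagEntry_sum_smul {κ : Type*} [Fintype κ] (U : unitaryGroup ι ℂ) (l : ι)
    (p : κ → ℝ) (A : κ → Matrix ι ι ℂ) :
    diagEntry U l (∑ i, (p i : ℂ) • A i) = ∑ i, p i * diagEntry U l (A i) := by
  simp [diagEntry, Matrix.mul_sum, Matrix.sum_mul, Matrix.sum_apply]

/-- The squared overlap of the `j`-th column of `V` and the `l`-th column of `U`. -/
noncomputable def overlap (V U : unitaryGroup ι ℂ) (j l : ι) : ℝ :=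
  Complex.normSq ((star (V : Matrix ι ι ℂ) * (U : Matrix ι ι ℂ)) j l)

lemma overlap_nonneg (V U : unitaryGroup ι ℂ) (j l : ι) : 0 ≤ overlap V U j l :=
  Complex.normSq_nonneg _

lemma diagEntry_specMat (V U : unitaryGroup ι ℂ) (D : ι → ℝ) (l : ι) :
    diagEntry U l (specMat V D) = ∑ j, overlap V U j l * D j := by
  have h : star (U : Matrix ι ι ℂ) * specMat V D * (U : Matrix ι ι ℂ) =
      star (star (V : Matrix ι ι ℂ) * (U : Matrix ι ι ℂ)) *
        (diagonal (fun i => (D i : ℂ)) * (star (V : Matrix ι ι ℂ) * (U : Matrix ι ι ℂ))) := by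
    simp only [specMat, star_mul, star_star, Matrix.mul_assoc]
  rw [diagEntry, h, Matrix.mul_apply, Complex.re_sum]
  refine Finset.sum_congr rfl fun j _ => ?_
  rw [diagonal_mul, star_apply, overlap, Complex.normSq_apply]
  simp only [Complex.star_def, Complex.mul_re, Complex.mul_im, Complex.conj_re, Complex.conj_im,
    Complex.ofReal_re, Complex.ofReal_im]
  ring

lemma sum_overlap (V U : unitaryGroup ι ℂ) (l : ι) : ∑ j, overlap V U j l = 1 := by
  have h := diagEntry_specMat V U (fun _ => 1) l
  have hV : (V : Matrix ι ι ℂ) * star (V : Matrix ι ι ℂ) = 1 := Unitary.coe_mul_star_self V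
  have hU : star (U : Matrix ι ι ℂ) * (U : Matrix ι ι ℂ) = 1 := Unitary.coe_star_mul_self U
  simpa [diagEntry, specMat, hV, hU] using h.symm

lemma overlap_self (U : unitaryGroup ι ℂ) (j l : ι) :
    overlap U U j l = if j = l then 1 else 0 := by
  have hU : star (U : Matrix ι ι ℂ) * (U : Matrix ι ι ℂ) = 1 := Unitary.coe_star_mul_self U
  rw [overlap, hU, Matrix.one_apply]
  split_ifs <;> simp

lemma diagEntry_eq_sum_overlap {A : Matrix ι ι ℂ} (hA : A.IsHermitian) (U : unitaryGroup ι ℂ)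
    (l : ι) : diagEntry U l A =
      ∑ j, overlap hA.eigenvectorUnitary U j l * hA.eigenvalues j := by
  conv_lhs => rw [eq_specMat hA]
  rw [diagEntry_specMat]

lemma diagEntry_eigenvectorUnitary {A : Matrix ι ι ℂ} (hA : A.IsHermitian) (l : ι) :
    diagEntry hA.eigenvectorUnitary l A = hA.eigenvalues l := by
  rw [diagEntry_eq_sum_overlap hA]
  simp [overlap_self]

/-- Peierls' inequality for the convex function `x ↦ x ^ r`. -/
lemma sum_diagEntry_rpow_le {C : Matrix ι ι ℂ} (hC : C.PosSemidef) (U : unitaryGroup ι ℂ)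
    {r : ℝ} (hr : 1 ≤ r) : ∑ l, diagEntry U l C ^ r ≤ (matRpow C r).trace.re := by
  rw [← sum_diagEntry U (matRpow C r)]
  refine Finset.sum_le_sum fun l _ => ?_
  rw [diagEntry_eq_sum_overlap hC.1, matRpow_eq_specMat hC.1, diagEntry_specMat]
  exact Real.rpow_arith_mean_le_arith_mean_rpow _ _ _ (fun j _ => overlap_nonneg _ _ j l)
    (sum_overlap _ _ l) (fun j _ => hC.eigenvalues_nonneg j) hr

end specMat

lemma sum_mul_pos_of_sum_eq_one {κ : Type*} [Fintype κ] {p x : κ → ℝ} (hp : ∀ i, 0 ≤ p i)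
    (hp1 : ∑ i, p i = 1) (hx : ∀ i, 0 < x i) : 0 < ∑ i, p i * x i := by
  obtain ⟨i, -, hi⟩ : ∃ i ∈ Finset.univ, 0 < p i :=
    Finset.exists_lt_of_sum_lt (by simp [hp1] : ∑ i : κ, (0 : ℝ) < ∑ i, p i)
  exact Finset.sum_pos' (fun i _ => mul_nonneg (hp i) (hx i).le)
    ⟨i, Finset.mem_univ i, mul_pos hi (hx i)⟩

lemma sum_mul_le_one_of_sum_eq_one {κ : Type*} [Fintype κ] {p x : κ → ℝ} (hp : ∀ i, 0 ≤ p i)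
    (hp1 : ∑ i, p i = 1) (hx : ∀ i, x i ≤ 1) : ∑ i, p i * x i ≤ 1 := by
  rw [← hp1]
  exact Finset.sum_le_sum fun i _ => mul_le_of_le_one_right (hp i) (hx i)

lemma rpow_le_rpow_add_mul_sub {a c r : ℝ} (hc : 0 < c) (hca : c ≤ a) (ha : a ≤ 1)
    (hr : 1 ≤ r) : a ^ r ≤ c ^ r + r * (a - c) := by
  have ha0 : 0 < a := hc.trans_le hca
  have hq : 0 < c / a := div_pos hc ha0
  have h := one_add_mul_self_le_rpow_one_add (s := c / a - 1) (by linarith) hr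
  rw [add_sub_cancel, Real.div_rpow hc.le ha0.le, le_div_iff₀ (Real.rpow_pos_of_pos ha0 r)] at h
  have h1 : a ^ r = a ^ (r - 1) * a := by
    rw [← Real.rpow_add_one ha0.ne', sub_add_cancel]
  have h2 : (1 + r * (c / a - 1)) * a ^ r = a ^ r - r * (a - c) * a ^ (r - 1) := by
    rw [h1]
    field_simp
    ring
  have h3 : a ^ (r - 1) ≤ 1 := Real.rpow_le_one ha0.le ha (by linarith)
  have h4 : r * (a - c) * a ^ (r - 1) ≤ r * (a - c) :=
    mul_le_of_le_one_right (mul_nonneg (by linarith) (by linarith)) h3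
  linarith

lemma sum_smul_isHermitian {ι κ : Type*} [Fintype κ] (p : κ → ℝ)
    {A : κ → Matrix ι ι ℂ} (hA : ∀ i, (A i).IsHermitian) : (∑ i, (p i : ℂ) • A i).IsHermitian := by
  simp only [Matrix.IsHermitian, conjTranspose_sum, conjTranspose_smul, (hA _).eq,
    Complex.star_def, Complex.conj_ofReal]

lemma trace_sum_smul_re {ι κ : Type*} [Fintype ι] [Fintype κ] (p : κ → ℝ)
    (A : κ → Matrix ι ι ℂ) :
    (∑ i, (p i : ℂ) • A i).trace.re = ∑ i, p i * (A i).trace.re := by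
  simp [Matrix.trace_sum]

section trace

variable {ι : Type*} [Fintype ι] [DecidableEq ι]

/-- A linear upper bound for `Tr A ^ r` around `C`, valid when in an eigenbasis of `A` the
diagonal of `C` is dominated by that of `A`. -/
lemma trace_matRpow_le {A C : Matrix ι ι ℂ} (hA : A.IsHermitian) (hC : C.PosSemidef)
    {r : ℝ} (hr : 1 ≤ r) (h0 : ∀ l, 0 < diagEntry hA.eigenvectorUnitary l C)
    (hle : ∀ l, diagEntry hA.eigenvectorUnitary l C ≤ diagEntry hA.eigenvectorUnitary l A)
    (h1 : ∀ l, diagEntry hA.eigenvectorUnitary l A ≤ 1) :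
    (matRpow A r).trace.re ≤ (matRpow C r).trace.re + r * (A.trace.re - C.trace.re) := by
  set U := hA.eigenvectorUnitary with hU
  calc (matRpow A r).trace.re = ∑ l, diagEntry U l A ^ r := by
        simp only [trace_matRpow_re hA, hU, diagEntry_eigenvectorUnitary]
    _ ≤ ∑ l, (diagEntry U l C ^ r + r * (diagEntry U l A - diagEntry U l C)) :=
        Finset.sum_le_sum fun l _ => rpow_le_rpow_add_mul_sub (h0 l) (hle l) (h1 l) hr
    _ = ∑ l, diagEntry U l C ^ r + r * (A.trace.re - C.trace.re) := by
        rw [Finset.sum_add_distrib, ← Finset.mul_sum, Finset.sum_sub_distrib, sum_diagEntry,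
          sum_diagEntry]
    _ ≤ _ := by
        gcongr
        exact sum_diagEntry_rpow_le hC U hr

lemma eigenvalues_le_one {A : Matrix ι ι ℂ} (hA : A.PosDef) (h1 : A.trace = 1) (j : ι) :
    hA.1.eigenvalues j ≤ 1 := by
  have h : A.trace.re = 1 := by simp [h1]
  rw [← h, trace_re_eq_sum_eigenvalues hA.1]
  exact Finset.single_le_sum (fun i _ => (hA.eigenvalues_pos i).le) (Finset.mem_univ j)

lemma diagEntry_pos {A : Matrix ι ι ℂ} (hA : A.PosDef) (U : unitaryGroup ι ℂ) (l : ι) :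
    0 < diagEntry U l A := by
  rw [diagEntry_eq_sum_overlap hA.1]
  exact sum_mul_pos_of_sum_eq_one (fun j => overlap_nonneg _ _ j l) (sum_overlap _ _ l)
    hA.eigenvalues_pos

lemma diagEntry_le_diagEntry_matRpow {A : Matrix ι ι ℂ} (hA : A.PosDef) (h1 : A.trace = 1)
    (U : unitaryGroup ι ℂ) (l : ι) {s : ℝ} (hs1 : s ≤ 1) :
    diagEntry U l A ≤ diagEntry U l (matRpow A s) := by
  rw [diagEntry_eq_sum_overlap hA.1, matRpow_eq_specMat hA.1, diagEntry_specMat]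
  refine Finset.sum_le_sum fun j _ => mul_le_mul_of_nonneg_left ?_ (overlap_nonneg _ _ j l)
  simpa using Real.rpow_le_rpow_of_exponent_ge (hA.eigenvalues_pos j)
    (eigenvalues_le_one hA h1 j) hs1

lemma diagEntry_matRpow_le_one {A : Matrix ι ι ℂ} (hA : A.PosDef) (h1 : A.trace = 1)
    (U : unitaryGroup ι ℂ) (l : ι) {s : ℝ} (hs : 0 ≤ s) :
    diagEntry U l (matRpow A s) ≤ 1 := by
  rw [matRpow_eq_specMat hA.1, diagEntry_specMat]
  exact sum_mul_le_one_of_sum_eq_one (fun j => overlap_nonneg _ _ j l) (sum_overlap _ _ l)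
    fun j => Real.rpow_le_one (hA.eigenvalues_pos j).le (eigenvalues_le_one hA h1 j) hs

lemma sum_smul_eigenvalues_pos {κ : Type*} [Fintype κ] {p : κ → ℝ} {A : κ → Matrix ι ι ℂ}
    (hA : ∀ i, (A i).PosDef) (hp : ∀ i, 0 ≤ p i) (hp1 : ∑ i, p i = 1)
    (hC : (∑ i, (p i : ℂ) • A i).IsHermitian) (j : ι) : 0 < hC.eigenvalues j := by
  rw [← diagEntry_eigenvectorUnitary hC, diagEntry_sum_smul]
  exact sum_mul_pos_of_sum_eq_one hp hp1 fun i => diagEntry_pos (hA i) _ _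

/-- The mutual information as a difference of entropies. -/
lemma sum_mul_trace_mul_matLog_sub {κ : Type*} [Fintype κ] (p : κ → ℝ) (W : κ → Matrix ι ι ℂ) :
    ∑ i, p i * ((W i * (matLog (W i) - matLog (∑ j, (p j : ℂ) • W j))).trace).re =
      ∑ i, p i * (W i * matLog (W i)).trace.re -
        ((∑ j, (p j : ℂ) • W j) * matLog (∑ j, (p j : ℂ) • W j)).trace.re := by
  set L := matLog (∑ j, (p j : ℂ) • W j)
  have h : ((∑ j, (p j : ℂ) • W j) * L).trace.re = ∑ i, p i * (W i * L).trace.re := by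
    rw [Matrix.sum_mul, ← trace_sum_smul_re]
    simp only [Matrix.smul_mul]
  rw [h, ← Finset.sum_sub_distrib]
  simp only [Matrix.trace_sub, Complex.sub_re, mul_sub]

end trace

lemma hasDerivAt_one_div_one_sub : HasDerivAt (fun t : ℝ => 1 / (1 - t)) 1 0 := by
  simpa using ((hasDerivAt_id (0 : ℝ)).const_sub 1).fun_inv (by simp)

lemma hasDerivAt_rpow_one_div_one_sub {a : ℝ} (ha : 0 < a) :
    HasDerivAt (fun t : ℝ => a ^ (1 / (1 - t))) (a * Real.log a) 0 := by
  simpa [mul_comm] using hasDerivAt_one_div_one_sub.const_rpow ha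

lemma hasDerivAt_rpow_one_sub {a : ℝ} (ha : 0 < a) :
    HasDerivAt (fun t : ℝ => a ^ (1 - t)) (-(a * Real.log a)) 0 := by
  simpa [mul_comm] using ((hasDerivAt_id (0 : ℝ)).const_sub 1).const_rpow ha

lemma exists_mem_Ioo_pos_of_hasDerivAt {f : ℝ → ℝ} {f' : ℝ} (h : HasDerivAt f f' 0)
    (h0 : f 0 = 0) (hf' : 0 < f') : ∃ t ∈ Set.Ioo (0 : ℝ) 1, 0 < f t := by
  have h1 := h.tendsto_slope_zero_right.eventually (lt_mem_nhds hf')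
  obtain ⟨t, ht, hmem⟩ := (h1.and (Ioo_mem_nhdsGT (zero_lt_one' ℝ))).exists
  refine ⟨t, hmem, ?_⟩
  simp only [zero_add, h0, sub_zero, smul_eq_mul] at ht
  exact (mul_pos_iff_of_pos_left (inv_pos.2 hmem.1)).1 ht

section channel

variable {k d : ℕ} {W : Fin k → Matrix (Fin d) (Fin d) ℂ} {p : Fin k → ℝ}

lemma trace_matRpow_sum_matRpow_le (hW : ∀ i, (W i).PosDef ∧ (W i).trace = 1)
    (hp : ∀ i, 0 ≤ p i) (hp1 : ∑ i, p i = 1) {t : ℝ} (ht : t ∈ Set.Ioo (0 : ℝ) 1) :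
    (matRpow (∑ i, (p i : ℂ) • matRpow (W i) (1 - t)) (1 / (1 - t))).trace.re ≤
      (matRpow (∑ i, (p i : ℂ) • W i) (1 / (1 - t))).trace.re +
        1 / (1 - t) * (∑ i, p i * (matRpow (W i) (1 - t)).trace.re - 1) := by
  obtain ⟨ht0, ht1⟩ := ht
  have hC : (∑ i, (p i : ℂ) • W i).IsHermitian := sum_smul_isHermitian p fun i => (hW i).1.1
  have hCp : (∑ i, (p i : ℂ) • W i).PosSemidef := hC.posSemidef_iff_eigenvalues_nonneg.2
    fun j => (sum_smul_eigenvalues_pos (fun i => (hW i).1) hp hp1 hC j).le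
  have hA : (∑ i, (p i : ℂ) • matRpow (W i) (1 - t)).IsHermitian :=
    sum_smul_isHermitian p fun i => matRpow_isHermitian (hW i).1.1 _
  have hr : 1 ≤ 1 / (1 - t) := by
    rw [le_div_iff₀ (by linarith)]
    linarith
  have h := trace_matRpow_le hA hCp hr
    (fun l => by
      rw [diagEntry_sum_smul]
      exact sum_mul_pos_of_sum_eq_one hp hp1 fun i => diagEntry_pos (hW i).1 _ _)
    (fun l => by
      rw [diagEntry_sum_smul, diagEntry_sum_smul]
      exact Finset.sum_le_sum fun i _ => mul_le_mul_of_nonneg_left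
        (diagEntry_le_diagEntry_matRpow (hW i).1 (hW i).2 _ _ (by linarith)) (hp i))
    (fun l => by
      rw [diagEntry_sum_smul]
      exact sum_mul_le_one_of_sum_eq_one hp hp1 fun i =>
        diagEntry_matRpow_le_one (hW i).1 (hW i).2 _ _ (by linarith))
  have hC1 : (∑ i, (p i : ℂ) • W i).trace.re = 1 := by
    rw [trace_sum_smul_re]
    simp [(hW _).2, hp1]
  rwa [hC1, trace_sum_smul_re] at h

lemma trace_matRpow_sum_matRpow_pos (hW : ∀ i, (W i).PosDef ∧ (W i).trace = 1)
    (hp : ∀ i, 0 ≤ p i) (hp1 : ∑ i, p i = 1) (t s : ℝ) :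
    0 < (matRpow (∑ i, (p i : ℂ) • matRpow (W i) (1 - t)) s).trace.re := by
  have hA : (∑ i, (p i : ℂ) • matRpow (W i) (1 - t)).IsHermitian :=
    sum_smul_isHermitian p fun i => matRpow_isHermitian (hW i).1.1 _
  have hk : Nonempty (Fin k) := by
    by_contra h
    rw [not_nonempty_iff] at h
    simp at hp1
  have hd : Nonempty (Fin d) := by
    by_contra h
    rw [not_nonempty_iff] at h
    simpa [Matrix.trace] using (hW hk.some).2
  rw [trace_matRpow_re hA]
  refine Finset.sum_pos (fun l _ => Real.rpow_pos_of_pos ?_ _) Finset.univ_nonempty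
  rw [← diagEntry_eigenvectorUnitary hA, diagEntry_sum_smul]
  refine sum_mul_pos_of_sum_eq_one hp hp1 fun i => ?_
  rw [matRpow_eq_specMat (hW i).1.1, diagEntry_specMat]
  exact sum_mul_pos_of_sum_eq_one (fun j => overlap_nonneg _ _ j l) (sum_overlap _ _ l)
    fun j => Real.rpow_pos_of_pos ((hW i).1.eigenvalues_pos j) _

end channel

lemma exists_phiW_sub_mul_pos {k d : ℕ} {W : Fin k → Matrix (Fin d) (Fin d) ℂ} {p : Fin k → ℝ}
    (hW : ∀ i, (W i).PosDef ∧ (W i).trace = 1) (hp : ∀ i, 0 ≤ p i) (hp1 : ∑ i, p i = 1) {R : ℝ}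
    (hR : R < ∑ i, p i *
      ((W i * (matLog (W i) - matLog (∑ j, (p j : ℂ) • W j))).trace).re) :
    ∃ t ∈ Set.Ioo (0 : ℝ) 1, 0 < phiW W p t - t * R := by
  have hC : (∑ i, (p i : ℂ) • W i).IsHermitian := sum_smul_isHermitian p fun i => (hW i).1.1
  have hμ := sum_smul_eigenvalues_pos (fun i => (hW i).1) hp hp1 hC
  have hW1 (i : Fin k) : ∑ j, (hW i).1.1.eigenvalues j = 1 := by
    rw [← trace_re_eq_sum_eigenvalues, (hW i).2, Complex.one_re]
  have hC1 : ∑ j, hC.eigenvalues j = 1 := by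
    rw [← trace_re_eq_sum_eigenvalues, trace_sum_smul_re]
    simp [(hW _).2, hp1]
  rw [sum_mul_trace_mul_matLog_sub, trace_mul_matLog_re hC] at hR
  simp only [fun i => trace_mul_matLog_re (hW i).1.1] at hR
  set h : ℝ → ℝ := fun t => ∑ j, hC.eigenvalues j ^ (1 / (1 - t)) +
    1 / (1 - t) * (∑ i, p i * ∑ j, (hW i).1.1.eigenvalues j ^ (1 - t) - 1) with hh
  have h0 : h 0 = 1 := by simp [hh, hC1, hW1, hp1]
  have hd1 : HasDerivAt (fun t : ℝ => ∑ j, hC.eigenvalues j ^ (1 / (1 - t)))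
      (∑ j, hC.eigenvalues j * Real.log (hC.eigenvalues j)) 0 :=
    HasDerivAt.fun_sum fun j _ => hasDerivAt_rpow_one_div_one_sub (hμ j)
  have hd2 : HasDerivAt (fun t : ℝ => ∑ i, p i * ∑ j, (hW i).1.1.eigenvalues j ^ (1 - t) - 1)
      (∑ i, p i * ∑ j, -((hW i).1.1.eigenvalues j * Real.log ((hW i).1.1.eigenvalues j))) 0 :=
    (HasDerivAt.fun_sum fun i _ => (HasDerivAt.fun_sum fun j _ =>
      hasDerivAt_rpow_one_sub ((hW i).1.eigenvalues_pos j)).const_mul (p i)).sub_const 1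
  have hd : HasDerivAt h (∑ j, hC.eigenvalues j * Real.log (hC.eigenvalues j) -
      ∑ i, p i * ∑ j, (hW i).1.1.eigenvalues j * Real.log ((hW i).1.1.eigenvalues j)) 0 := by
    refine (hd1.fun_add (hasDerivAt_one_div_one_sub.fun_mul hd2)).congr_deriv ?_
    simp [hW1, hp1, sub_eq_add_neg]
  have hf := ((((hasDerivAt_id (0 : ℝ)).const_sub 1).neg).mul (hd.log (by simp [h0]))).sub
    ((hasDerivAt_id (0 : ℝ)).mul_const R)
  obtain ⟨t, ht, hpos⟩ := exists_mem_Ioo_pos_of_hasDerivAt hf (by simp [h0])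
    (by simp [h0]; linarith)
  refine ⟨t, ht, hpos.trans_le ?_⟩
  have hle := trace_matRpow_sum_matRpow_le hW hp hp1 ht
  rw [trace_matRpow_re hC] at hle
  simp only [fun i => trace_matRpow_re (hW i).1.1] at hle
  have hlog := Real.log_le_log (trace_matRpow_sum_matRpow_pos hW hp hp1 t _) hle
  have hmul := mul_le_mul_of_nonneg_left hlog (sub_nonneg.2 ht.2.le)
  simp only [Pi.sub_apply, Pi.mul_apply, Pi.neg_apply, id, phiW, hh, neg_mul]
  linarith

/-- If the rate `R` is below the quantum mutual information
`I(p,W) = ∑ᵢ pᵢ Tr[W(i)(log W(i) - log W_p)]`, then `φ_{W,p}(t) - tR > 0` for some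
`t ∈ (0,1)`; consequently `sup_{0 ≤ t < 1} (φ_{W,p}(t) - tR)/(1+t) > 0`. -/
theorem exponent_positive (k d : ℕ) (W : Fin k → Matrix (Fin d) (Fin d) ℂ)
    (hW : ∀ i, (W i).PosDef ∧ (W i).trace = 1)
    (p : Fin k → ℝ) (hp : ∀ i, 0 ≤ p i) (hp1 : ∑ i, p i = 1) (R : ℝ)
    (hR : R < ∑ i, p i *
      ((W i * (matLog (W i) - matLog (∑ j, (p j : ℂ) • W j))).trace).re) :
    (∃ t ∈ Set.Ioo (0 : ℝ) 1, 0 < phiW W p t - t * R) ∧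
    (0 : EReal) < ⨆ t : Set.Ico (0 : ℝ) 1,
      (((phiW W p t.1 - t.1 * R) / (1 + t.1) : ℝ) : EReal) := by
  obtain ⟨t, ht, hpos⟩ := exists_phiW_sub_mul_pos hW hp hp1 hR
  refine ⟨⟨t, ht, hpos⟩, ?_⟩
  refine lt_of_lt_of_le ?_ (le_iSup _ (⟨t, ht.1.le, ht.2⟩ : Set.Ico (0 : ℝ) 1))
  exact EReal.coe_pos.2 (div_pos hpos (by linarith [ht.1]))
end
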